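/- arXiv:2407.04837 — 9 statements merged into one kernel-verified Lean document; each statement's English description precedes it below -/
import Mathlib

section
/- There exists a Borel set E ⊆ [0,1]² with Hausdorff dimension dim(E) ≥ 1 (so dim(E) ∈ [1,2]) such that for every affine line L in ℝ², the intersection E ∩ L has Hausdorff dimension 0. In particular, sup{dim(E ∩ L) : L an affine line in ℝ²} = 0. Such a set E can be taken of the form A × B where A = {Σ_{j≥1} a_j 2^{-j} : a_j ∈ {0,1}, a_j = 0 for m_{2k} ≤ j < m_{2k+1} for all k} and B = {Σ_{j≥1} b_j 2^{-j} : b_j ∈ {0,1}, b_j = 0 for m_{2k-1} ≤ j < m_{2k} for all k}, with m_k = 10^{10^k}. -/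
open Set MeasureTheory Metric Real
open scoped ENNReal NNReal

noncomputable section

/-- The plane `ℝ²` with the Euclidean metric. -/
abbrev E2 : Type := EuclideanSpace ℝ (Fin 2)

/-- The sequence `m_k = 10^(10^k)`. -/
def mseq (k : ℕ) : ℕ := 10 ^ (10 ^ k)

/-- `A = { Σ_{j≥1} a_j 2^{-j} : a_j ∈ {0,1}, a_j = 0 for m_{2k} ≤ j < m_{2k+1} for all k }`. -/
def setA : Set ℝ :=
  {x | ∃ a : ℕ → ℕ, (∀ j, a j ≤ 1) ∧ a 0 = 0 ∧
    (∀ k j, 1 ≤ k → mseq (2 * k) ≤ j → j < mseq (2 * k + 1) → a j = 0) ∧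
    x = ∑' j : ℕ, (a j : ℝ) / 2 ^ j}

/-- `B = { Σ_{j≥1} b_j 2^{-j} : b_j ∈ {0,1}, b_j = 0 for m_{2k-1} ≤ j < m_{2k} for all k }`. -/
def setB : Set ℝ :=
  {x | ∃ b : ℕ → ℕ, (∀ j, b j ≤ 1) ∧ b 0 = 0 ∧
    (∀ k j, 1 ≤ k → mseq (2 * k - 1) ≤ j → j < mseq (2 * k) → b j = 0) ∧
    x = ∑' j : ℕ, (b j : ℝ) / 2 ^ j}

/-- The product set `E = A × B ⊆ ℝ²`. -/
def setE : Set E2 := {p | p 0 ∈ setA ∧ p 1 ∈ setB}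

open Filter Topology

/-- The real number `Σ_j a_j 2^{-j}`. -/
def digitSum (a : ℕ → ℕ) : ℝ := ∑' j : ℕ, (a j : ℝ) / 2 ^ j

/-- The binary digit sequences vanishing on `Z`. -/
def binarySeqs (Z : Set ℕ) : Set (ℕ → ℕ) := {a | ∀ j, a j ≤ 1 ∧ (j ∈ Z → a j = 0)}

lemma binary_term_le {n : ℕ} (hn : n ≤ 1) (j : ℕ) : (n : ℝ) / 2 ^ j ≤ (1 / 2 : ℝ) ^ j := by
  rw [div_pow, one_pow]
  gcongr
  exact_mod_cast hn

lemma summable_binary {a : ℕ → ℕ} (ha : ∀ j, a j ≤ 1) :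
    Summable fun j : ℕ => (a j : ℝ) / 2 ^ j :=
  Summable.of_nonneg_of_le (fun _ => by positivity) (fun j => binary_term_le (ha j) j)
    summable_geometric_two

lemma isCompact_digitSum_image (Z : Set ℕ) : IsCompact (digitSum '' binarySeqs Z) := by
  have hc : IsCompact (binarySeqs Z) := by
    have : binarySeqs Z = Set.pi univ fun j => {n : ℕ | n ≤ 1 ∧ (j ∈ Z → n = 0)} := by
      ext a; simp [binarySeqs]
    rw [this]
    exact isCompact_univ_pi fun j =>
      ((Set.finite_Iic 1).subset fun n hn => hn.1).isCompact
  refine hc.image_of_continuousOn ?_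
  refine continuousOn_tsum (u := fun j => (1 / 2 : ℝ) ^ j) (fun j => ?_)
    summable_geometric_two fun j a ha => ?_
  · refine Continuous.continuousOn ?_
    have : Continuous fun n : ℕ => (n : ℝ) := continuous_of_discreteTopology
    exact (this.comp (continuous_apply j)).div_const _
  · rw [Real.norm_of_nonneg (by positivity)]
    exact binary_term_le (ha j).1 j

lemma digitSum_eq_sum_add {a : ℕ → ℕ} (ha : ∀ j, a j ≤ 1) (q : ℕ) :
    digitSum a = ∑ j ∈ Finset.range q, (a j : ℝ) / 2 ^ j
      + digitSum (fun j => a (j + q)) / 2 ^ q := by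
  rw [digitSum, ← (summable_binary ha).sum_add_tsum_nat_add q, digitSum, ← tsum_div_const]
  congr 1
  refine tsum_congr fun j => ?_
  rw [pow_add, div_div]

lemma digitSum_nonneg (a : ℕ → ℕ) : 0 ≤ digitSum a := tsum_nonneg fun _ => by positivity

lemma digitSum_le_two {a : ℕ → ℕ} (ha : ∀ j, a j ≤ 1) : digitSum a ≤ 2 := by
  rw [← tsum_geometric_two]
  exact (summable_binary ha).tsum_le_tsum (fun j => binary_term_le (ha j) j)
    summable_geometric_two

lemma digitSum_mem_Icc {a : ℕ → ℕ} (ha : ∀ j, a j ≤ 1) (h0 : a 0 = 0) :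
    digitSum a ∈ Icc (0 : ℝ) 1 := by
  refine ⟨digitSum_nonneg a, ?_⟩
  have h := digitSum_le_two fun j => ha (j + 1)
  rw [digitSum_eq_sum_add ha 1]
  simp only [Finset.range_one, Finset.sum_singleton, h0]
  norm_num
  linarith

/-- If `Z` contains arbitrarily late blocks `[p, p²)`, the reals whose binary digits vanish on `Z`
form a set of Hausdorff dimension zero. -/
lemma dimH_digitSum_image_eq_zero {Z : Set ℕ} {p : ℕ → ℕ} (hp : Tendsto p atTop atTop)
    (hZ : ∀ k j, p k ≤ j → j < p k ^ 2 → j ∈ Z) : dimH (digitSum '' binarySeqs Z) = 0 := by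
  suffices h : ∀ s : ℝ≥0, 0 < s → dimH (digitSum '' binarySeqs Z) ≤ s from
    nonpos_iff_eq_zero.1 <| ENNReal.le_of_forall_pos_le_add fun s hs _ => by
      simpa using h s hs
  intro s hs
  have hs' : (0 : ℝ) < s := hs
  apply dimH_le_of_hausdorffMeasure_ne_top
  let t : ∀ k, (Fin (p k) → Fin 2) → Set ℝ := fun k e =>
    Icc (∑ i, (e i : ℝ) / 2 ^ (i : ℕ)) (∑ i, (e i : ℝ) / 2 ^ (i : ℕ) + 2 / 2 ^ (p k ^ 2))
  have ht : ∀ k e, ediam (t k e) = ENNReal.ofReal (2 / 2 ^ (p k ^ 2)) := fun k e => by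
    simp only [t, Real.ediam_Icc, add_sub_cancel_left]
  have hr : Tendsto (fun k => ENNReal.ofReal (2 / 2 ^ (p k ^ 2))) atTop (𝓝 0) := by
    have hq : Tendsto (fun k => p k ^ 2) atTop atTop :=
      (tendsto_pow_atTop two_ne_zero).comp hp
    have h2 : Tendsto (fun n : ℕ => (2 : ℝ) / 2 ^ n) atTop (𝓝 0) :=
      tendsto_const_nhds.div_atTop (tendsto_pow_atTop_atTop_of_one_lt one_lt_two)
    simpa using ENNReal.tendsto_ofReal (h2.comp hq)
  have hcov : ∀ k, digitSum '' binarySeqs Z ⊆ ⋃ e, t k e := by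
    rintro k _ ⟨a, ha, rfl⟩
    refine mem_iUnion.2 ⟨fun i => ⟨a i, Nat.lt_succ_of_le (ha i).1⟩, ?_⟩
    have hle : p k ≤ p k ^ 2 := Nat.le_self_pow two_ne_zero _
    have hsum : ∑ j ∈ Finset.range (p k ^ 2), (a j : ℝ) / 2 ^ j
        = ∑ i : Fin (p k), (a i : ℝ) / 2 ^ (i : ℕ) := by
      rw [Fin.sum_univ_eq_sum_range fun j => (a j : ℝ) / 2 ^ j]
      refine (Finset.sum_subset (Finset.range_mono hle) fun j hj hj' => ?_).symm
      rw [Finset.mem_range] at hj hj'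
      simp [(ha j).2 (hZ k j (not_lt.1 hj') hj)]
    have h0 := digitSum_nonneg fun j => a (j + p k ^ 2)
    have h2 := digitSum_le_two fun j => (ha (j + p k ^ 2)).1
    simp only [t]
    rw [digitSum_eq_sum_add (fun j => (ha j).1) (p k ^ 2), hsum]
    refine ⟨le_add_of_nonneg_right (by positivity), ?_⟩
    gcongr
  have hle := Measure.hausdorffMeasure_le_liminf_sum (s : ℝ) (digitSum '' binarySeqs Z)
    _ hr t (Eventually.of_forall fun k e => (ht k e).le) (Eventually.of_forall hcov)
  have hbound : ∀ᶠ k in atTop,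
      ∑ e, ediam (t k e) ^ (s : ℝ) ≤ ENNReal.ofReal ((2 : ℝ) ^ (s : ℝ)) := by
    filter_upwards [(tendsto_natCast_atTop_atTop (R := ℝ).comp hp).eventually_ge_atTop
      (1 / (s : ℝ))] with k hk
    have hk' : 1 ≤ (s : ℝ) * p k := by
      rw [mul_comm]; exact (div_le_iff₀ hs').1 hk
    have hexp : (p k : ℝ) ≤ (p k ^ 2 : ℕ) * (s : ℝ) := by
      push_cast
      nlinarith [Nat.cast_nonneg (α := ℝ) (p k)]
    simp only [ht, Finset.sum_const, Finset.card_univ, Fintype.card_fun, Fintype.card_fin,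
      nsmul_eq_mul]
    rw [ENNReal.ofReal_rpow_of_nonneg (by positivity) hs'.le, ← ENNReal.ofReal_natCast,
      ← ENNReal.ofReal_mul (by positivity)]
    apply ENNReal.ofReal_le_ofReal
    rw [Real.div_rpow (by norm_num) (by positivity), ← Real.rpow_natCast 2 (p k ^ 2),
      ← Real.rpow_mul (by norm_num), mul_div_assoc', div_le_iff₀ (by positivity), mul_comm]
    gcongr
    push_cast
    rw [← Real.rpow_natCast]
    exact Real.rpow_le_rpow_of_exponent_le one_le_two (by exact_mod_cast hexp)
  exact ne_top_of_le_ne_top ENNReal.ofReal_ne_top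
    (hle.trans (liminf_le_of_le (by isBoundedDefault) fun b hb => by
      obtain ⟨k, h1, h2⟩ := (hb.and hbound).exists
      exact h1.trans h2))

/-- The positions, together with `0`, where the digits of elements of `setA` vanish. -/
def zerosA : Set ℕ := {j | j = 0 ∨ ∃ k, 1 ≤ k ∧ mseq (2 * k) ≤ j ∧ j < mseq (2 * k + 1)}

/-- The positions, together with `0`, where the digits of elements of `setB` vanish. -/
def zerosB : Set ℕ := {j | j = 0 ∨ ∃ k, 1 ≤ k ∧ mseq (2 * k - 1) ≤ j ∧ j < mseq (2 * k)}

lemma setA_eq : setA = digitSum '' binarySeqs zerosA := by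
  ext x
  constructor
  · rintro ⟨a, h1, h0, h, rfl⟩
    refine ⟨a, fun j => ⟨h1 j, ?_⟩, rfl⟩
    rintro (rfl | ⟨k, hk, hj, hj'⟩)
    exacts [h0, h k j hk hj hj']
  · rintro ⟨a, ha, rfl⟩
    exact ⟨a, fun j => (ha j).1, (ha 0).2 (Or.inl rfl),
      fun k j hk hj hj' => (ha j).2 (Or.inr ⟨k, hk, hj, hj'⟩), rfl⟩

lemma setB_eq : setB = digitSum '' binarySeqs zerosB := by
  ext x
  constructor
  · rintro ⟨a, h1, h0, h, rfl⟩
    refine ⟨a, fun j => ⟨h1 j, ?_⟩, rfl⟩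
    rintro (rfl | ⟨k, hk, hj, hj'⟩)
    exacts [h0, h k j hk hj hj']
  · rintro ⟨a, ha, rfl⟩
    exact ⟨a, fun j => (ha j).1, (ha 0).2 (Or.inl rfl),
      fun k j hk hj hj' => (ha j).2 (Or.inr ⟨k, hk, hj, hj'⟩), rfl⟩

lemma mseq_strictMono : StrictMono mseq := fun _ _ h =>
  Nat.pow_lt_pow_right (by norm_num) (Nat.pow_lt_pow_right (by norm_num) h)

lemma mseq_sq_le (k : ℕ) : mseq k ^ 2 ≤ mseq (k + 1) := by
  rw [mseq, mseq, ← pow_mul, pow_succ 10 k]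
  exact Nat.pow_le_pow_right (by norm_num) (by gcongr; norm_num)

lemma dimH_setA : dimH setA = 0 := by
  rw [setA_eq]
  refine dimH_digitSum_image_eq_zero (p := fun k => mseq (2 * (k + 1)))
    (mseq_strictMono.tendsto_atTop.comp (StrictMono.tendsto_atTop fun _ _ h => by omega))
    fun k j hj hj' => Or.inr ⟨k + 1, by omega, hj, hj'.trans_le (mseq_sq_le _)⟩

lemma dimH_setB : dimH setB = 0 := by
  rw [setB_eq]
  refine dimH_digitSum_image_eq_zero (p := fun k => mseq (2 * k + 1))
    (mseq_strictMono.tendsto_atTop.comp (StrictMono.tendsto_atTop fun _ _ h => by omega))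
    fun k j hj hj' => Or.inr ⟨k + 1, by omega, hj, hj'.trans_le (mseq_sq_le _)⟩

lemma notMem_zerosB {j : ℕ} (hj : j ≠ 0) (hA : j ∈ zerosA) : j ∉ zerosB := by
  rintro (h | ⟨l, -, hl, hl'⟩)
  · exact hj h
  obtain h | ⟨k, -, hk, hk'⟩ := hA
  · exact hj h
  have h1 := mseq_strictMono.lt_iff_lt.1 (hk.trans_lt hl')
  have h2 := mseq_strictMono.lt_iff_lt.1 (hl.trans_lt hk')
  omega

lemma exists_digitSum_eq {x : ℝ} (hx : x ∈ Ico (0 : ℝ) 1) :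
    ∃ c : ℕ → ℕ, (∀ j, c j ≤ 1) ∧ c 0 = 0 ∧ digitSum c = x := by
  let c : ℕ → ℕ := fun j => if j = 0 then 0 else Real.digits x 2 (j - 1)
  have hc : ∀ j, c j ≤ 1 := fun j => by
    simp only [c]
    split_ifs
    · exact zero_le_one
    · omega
  refine ⟨c, hc, rfl, ?_⟩
  rw [← Real.ofDigits_digits one_lt_two hx, digitSum, (summable_binary hc).tsum_eq_zero_add,
    Real.ofDigits]
  simp [c, Real.ofDigitsTerm, div_eq_mul_inv]

lemma Ico_subset_image_setE : Ico (0 : ℝ) 1 ⊆ (fun p : E2 => p 0 + p 1) '' setE := by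
  classical
  intro x hx
  obtain ⟨c, hc, hc0, rfl⟩ := exists_digitSum_eq hx
  let a : ℕ → ℕ := fun j => if j ∈ zerosA then 0 else c j
  let b : ℕ → ℕ := fun j => if j ∈ zerosA then c j else 0
  have ha : a ∈ binarySeqs zerosA := fun j => by
    simp only [a]
    split_ifs with h
    · simp
    · exact ⟨hc j, fun h' => absurd h' h⟩
  have hb : b ∈ binarySeqs zerosB := fun j => by
    simp only [b]
    split_ifs with h
    · refine ⟨hc j, fun h' => ?_⟩
      by_contra hj
      exact notMem_zerosB (fun h0 => hj (h0 ▸ hc0)) h h'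
    · simp
  refine ⟨!₂[digitSum a, digitSum b], ⟨?_, ?_⟩, ?_⟩
  · rw [setA_eq]
    exact ⟨a, ha, by simp⟩
  · rw [setB_eq]
    exact ⟨b, hb, by simp⟩
  · have hab : ∀ j, (c j : ℝ) / 2 ^ j = (a j : ℝ) / 2 ^ j + (b j : ℝ) / 2 ^ j := fun j => by
      simp only [a, b]
      split_ifs <;> simp
    simp only [digitSum, hab]
    rw [Summable.tsum_add (summable_binary fun j => (ha j).1) (summable_binary fun j => (hb j).1)]
    simp

lemma one_le_dimH_setE : 1 ≤ dimH setE := by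
  have h1 : dimH (Ico (0 : ℝ) 1) = 1 := by
    simpa using Real.dimH_of_nonempty_interior (s := Ico (0 : ℝ) 1) (by simp)
  have hf : ContDiff ℝ 1 fun p : E2 => p 0 + p 1 := by fun_prop
  calc 1 = dimH (Ico (0 : ℝ) 1) := h1.symm
    _ ≤ dimH ((fun p : E2 => p 0 + p 1) '' setE) := dimH_mono Ico_subset_image_setE
    _ ≤ dimH setE := hf.contDiffOn.dimH_image_le convex_univ (subset_univ _)

/-- A subset of a line has dimension zero if all its coordinate projections lie in sets of
dimension zero. -/
lemma dimH_inter_line_eq_zero {ι : Type*} [Fintype ι] {E : Set (EuclideanSpace ℝ ι)}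
    {S : ι → Set ℝ} (hS : ∀ i, dimH (S i) = 0) (hE : ∀ p ∈ E, ∀ i, p i ∈ S i)
    (L : AffineSubspace ℝ (EuclideanSpace ℝ ι)) (hL : Module.finrank ℝ L.direction = 1) :
    dimH (E ∩ (L : Set (EuclideanSpace ℝ ι))) = 0 := by
  obtain hem | ⟨p₀, -, hp₀⟩ := (E ∩ (L : Set (EuclideanSpace ℝ ι))).eq_empty_or_nonempty
  · rw [hem, dimH_empty]
  obtain ⟨⟨v, hvL⟩, hv, hspan⟩ := finrank_eq_one_iff'.1 hL
  obtain ⟨i, hi⟩ : ∃ i, v i ≠ 0 := by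
    by_contra! h
    exact hv (Subtype.ext (PiLp.ext h))
  let f : ℝ → EuclideanSpace ℝ ι := fun x => p₀ + ((x - p₀ i) / v i) • v
  have hf : ContDiff ℝ 1 f := by fun_prop
  have hsub : E ∩ (L : Set (EuclideanSpace ℝ ι)) ⊆ f '' S i := by
    rintro p ⟨hpE, hpL⟩
    refine ⟨p i, hE p hpE i, ?_⟩
    obtain ⟨c, hc⟩ := hspan ⟨p -ᵥ p₀, AffineSubspace.vsub_mem_direction hpL hp₀⟩
    have hc' : c • v = p - p₀ := congrArg Subtype.val hc
    have hci : c * v i = p i - p₀ i := by simpa using congrArg (fun w => w i) hc'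
    simp only [f]
    rw [← hci, mul_div_cancel_right₀ _ hi, hc', add_sub_cancel]
  exact nonpos_iff_eq_zero.1 <| (dimH_mono hsub).trans <|
    (hf.contDiffOn.dimH_image_le convex_univ (subset_univ _)).trans (hS i).le

/-- There is a Borel set `E ⊆ [0,1]²` with Hausdorff dimension at least `1` such that
`E ∩ L` has Hausdorff dimension `0` for every affine line `L` in the plane; one may take
`E = A × B` as above. -/
theorem statement0 :
    MeasurableSet setE ∧
    setE ⊆ {p : E2 | p 0 ∈ Icc (0:ℝ) 1 ∧ p 1 ∈ Icc (0:ℝ) 1} ∧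
    1 ≤ dimH setE ∧
    (∀ L : AffineSubspace ℝ E2, Module.finrank ℝ L.direction = 1 →
      dimH (setE ∩ (L : Set E2)) = 0) := by
  have hA : MeasurableSet setA := by
    rw [setA_eq]; exact (isCompact_digitSum_image _).measurableSet
  have hB : MeasurableSet setB := by
    rw [setB_eq]; exact (isCompact_digitSum_image _).measurableSet
  refine ⟨?_, ?_, one_le_dimH_setE, ?_⟩
  · have h (i : Fin 2) : Measurable fun p : E2 => p i := by fun_prop
    exact (h 0 hA).inter (h 1 hB)
  · rintro p ⟨⟨a, ha, ha0, -, h⟩, ⟨b, hb, hb0, -, h'⟩⟩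
    exact ⟨h ▸ digitSum_mem_Icc ha ha0, h' ▸ digitSum_mem_Icc hb hb0⟩
  · refine dimH_inter_line_eq_zero (S := ![setA, setB]) ?_ ?_
    · simp [Fin.forall_fin_two, dimH_setA, dimH_setB]
    · intro p hp
      simpa [Fin.forall_fin_two, setE] using hp
end
end

section
/- For every m ∈ ℕ let s_m be the unique positive real number satisfying 2·4^{-s_m} + 4^{-s_m}·Σ_{k=0}^{m-1} (2·4^{-s_m})^k = 1 (the similarity dimension of the sub-IFS F_m of the 4-corner Cantor IFS). Then for any N ∈ ℕ there exists a constant c = c(N) > 0 such that whenever m ≥ N, it holds that s_m ≥ 1 − c/2^m. -/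
open Set Real
open scoped ENNReal NNReal

noncomputable section

theorem le_of_dimension_equation {x : ℝ} {m : ℕ}
    (h : 2 * x + x * ∑ k ∈ Finset.range m, (2 * x) ^ k = 1) :
    4 * x ≤ 1 + 1 / 2 ^ m := by
  rcases le_total x (1 / 4) with hx | hx
  · have : (0 : ℝ) < 1 / 2 ^ m := by positivity
    linarith
  · have hmono : ∑ k ∈ Finset.range m, (1 / 2 : ℝ) ^ k ≤ ∑ k ∈ Finset.range m, (2 * x) ^ k :=
      Finset.sum_le_sum fun k _ => pow_le_pow_left₀ (by norm_num) (by linarith) k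
    have hgeom : ∑ k ∈ Finset.range m, (1 / 2 : ℝ) ^ k = 2 - 2 * (1 / 2 ^ m) := by
      rw [geom_sum_eq (by norm_num), one_div_pow]
      ring
    have hnonneg : 0 ≤ ∑ k ∈ Finset.range m, (1 / 2 : ℝ) ^ k :=
      Finset.sum_nonneg fun k _ => by positivity
    have hmul := mul_le_mul hx hmono hnonneg (by linarith)
    linarith

/-- For `s_m` the unique positive real with
`2·4^{-s_m} + 4^{-s_m}·Σ_{k=0}^{m-1} (2·4^{-s_m})^k = 1` (the similarity dimension of the
sub-IFS `F_m` of the 4-corner Cantor IFS), for every `N` there is `c = c(N) > 0` such that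
`s_m ≥ 1 − c/2^m` whenever `m ≥ N`. -/
theorem statement4 (s : ℕ → ℝ) (hpos : ∀ m, 0 < s m)
    (heq : ∀ m, 2 * (4 : ℝ) ^ (-(s m)) +
      (4 : ℝ) ^ (-(s m)) * ∑ k ∈ Finset.range m, (2 * (4 : ℝ) ^ (-(s m))) ^ k = 1) :
    ∀ N : ℕ, ∃ c : ℝ, 0 < c ∧ ∀ m : ℕ, N ≤ m → 1 - c / 2 ^ m ≤ s m := by
  intro N
  refine ⟨1, one_pos, fun m _ => ?_⟩
  have hx := le_of_dimension_equation (heq m)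
  have hexp : (4 : ℝ) * 4 ^ (-(s m)) = Real.exp (Real.log 4 * (1 - s m)) := by
    rw [← Real.rpow_def_of_pos (by norm_num), sub_eq_add_neg, Real.rpow_add (by norm_num),
      Real.rpow_one]
  have hlog : 1 ≤ Real.log 4 := by
    rw [show (4 : ℝ) = 2 ^ 2 by norm_num, Real.log_pow]
    have := Real.log_two_gt_d9
    push_cast
    linarith
  have hlin := Real.add_one_le_exp (Real.log 4 * (1 - s m))
  have hpow : (0 : ℝ) < 1 / 2 ^ m := by positivity
  rcases le_total 1 (s m) with hs | hs
  · linarith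
  · have := mul_le_mul_of_nonneg_right hlog (sub_nonneg.2 hs)
    linarith
end
end

section
/- Let C₄ be the 4-corner Cantor set. There exists a universal constant c > 0 such that for every ε ∈ (0,1) there exists a Lipschitz graph Γ ⊆ ℝ² satisfying dim(C₄ ∩ Γ) ≥ 1 − ε and Lip(Γ) ≤ c·ε⁻². -/
open Set MeasureTheory Metric Real
open scoped ENNReal NNReal

noncomputable section

/-- The point `(x, y) ∈ ℝ²`. -/
def pt (x y : ℝ) : E2 := (WithLp.equiv 2 (Fin 2 → ℝ)).symm ![x, y]

/-- The translations of the four maps `f_j(x) = x/4 + z_j` of the 4-corner Cantor IFS. -/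
def cantorZ : Fin 4 → E2 := ![pt 0 0, pt 0 (3 / 4), pt (3 / 4) 0, pt (3 / 4) (3 / 4)]

/-- `Γ ⊆ ℝ²` is a Lipschitz graph with Lipschitz constant at most `L`: it is the image under
a rotation (linear isometry) of the graph of an `L`-Lipschitz function `g` over an interval. -/
def IsLipGraph (Γ : Set E2) (L : ℝ) : Prop :=
  ∃ (I : Set ℝ) (g : ℝ → ℝ) (R : E2 ≃ₗᵢ[ℝ] E2),
    I.OrdConnected ∧ LipschitzOnWith (Real.toNNReal L) g I ∧
    Γ = R '' ((fun x => pt x (g x)) '' I)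

/-- The points `∑ rⁿ z(aₙ)` coded by sequences `a`, for the maps `x ↦ r x + z i` leaving `K`
invariant. -/
theorem exists_coding {E ι : Type*} [NormedAddCommGroup E] [NormedSpace ℝ E] [CompleteSpace E]
    [Finite ι] {K : Set E} (hK : IsClosed K) (hne : K.Nonempty) {r : ℝ} (hr0 : 0 ≤ r)
    (hr1 : r < 1) (z : ι → E) (hz : ∀ i, ∀ x ∈ K, r • x + z i ∈ K) :
    ∃ P : (ℕ → ι) → E, (∀ a, P a ∈ K) ∧ ∀ a, P a = r • P (fun n => a (n + 1)) + z (a 0) := by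
  obtain ⟨M, hM⟩ := (Set.finite_range fun i => ‖z i‖).bddAbove
  have hs (a : ℕ → ι) : Summable fun n => r ^ n • z (a n) := by
    refine Summable.of_norm_bounded ((summable_geometric_of_lt_one hr0 hr1).mul_right M) fun n => ?_
    rw [norm_smul, norm_pow, Real.norm_of_nonneg hr0]
    exact mul_le_mul_of_nonneg_left (hM ⟨_, rfl⟩) (by positivity)
  refine ⟨fun a => ∑' n, r ^ n • z (a n), fun a => ?_, fun a => ?_⟩
  · obtain ⟨x, hx⟩ := hne
    have hfin : ∀ (n : ℕ) (a : ℕ → ι),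
        ∑ i ∈ Finset.range n, r ^ i • z (a i) + r ^ n • x ∈ K := by
      intro n
      induction n with
      | zero => intro a; simpa using hx
      | succ n ih =>
        intro a
        convert! hz (a 0) _ (ih fun n => a (n + 1)) using 1
        rw [Finset.sum_range_succ', smul_add, Finset.smul_sum]
        simp only [smul_smul, pow_succ', pow_zero, one_smul]
        abel
    have h0 : Filter.Tendsto (fun n : ℕ => r ^ n • x) Filter.atTop (nhds 0) := by
      simpa using (tendsto_pow_atTop_nhds_zero_of_lt_one hr0 hr1).smul_const x
    have hlim := (hs a).hasSum.tendsto_sum_nat.add h0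
    rw [add_zero] at hlim
    exact hK.mem_of_tendsto hlim (Filter.Eventually.of_forall fun n => hfin n a)
  · dsimp only
    rw [(hs a).tsum_eq_zero_add, ← (hs fun n => a (n + 1)).tsum_const_smul]
    simp only [smul_smul, pow_succ', pow_zero, one_smul]
    abel

theorem coding_sub_coding {E ι : Type*} [AddCommGroup E] [Module ℝ E] {r : ℝ} {z : ι → E}
    {P : (ℕ → ι) → E} (hP : ∀ a, P a = r • P (fun n => a (n + 1)) + z (a 0)) :
    ∀ (k : ℕ) (a b : ℕ → ι), (∀ i < k, a i = b i) →
      P a - P b = r ^ k • (P (fun n => a (n + k)) - P (fun n => b (n + k))) := by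
  intro k
  induction k with
  | zero => intro a b _; simp
  | succ k ih =>
    intro a b h
    rw [hP a, hP b, h 0 k.succ_pos, add_sub_add_right_eq_sub, ← smul_sub,
      ih _ _ fun i hi => h (i + 1) (by omega), smul_smul, ← pow_succ']
    simp only [add_assoc]

/-- The linear functional `(x, y) ↦ x + 2 * y`. -/
def tiltedProj : E2 →L[ℝ] ℝ := EuclideanSpace.proj 0 + (2 : ℝ) • EuclideanSpace.proj 1

theorem tiltedProj_apply (p : E2) : tiltedProj p = p 0 + 2 * p 1 := by
  simp [tiltedProj]

theorem tiltedProj_cantorZ_mem (j : Fin 4) : tiltedProj (cantorZ j) ∈ Set.Icc (0 : ℝ) (9 / 4) := by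
  fin_cases j <;> norm_num [tiltedProj_apply, cantorZ, pt]

theorem exists_tiltedProj_cantorZ {d : ℕ} (hd : d < 4) :
    ∃ j, tiltedProj (cantorZ j) = 3 * d / 4 := by
  interval_cases d
  · exact ⟨0, by norm_num [tiltedProj_apply, cantorZ, pt]⟩
  · exact ⟨2, by rw [show cantorZ 2 = pt (3 / 4) 0 from rfl]; norm_num [tiltedProj_apply, pt]⟩
  · exact ⟨1, by norm_num [tiltedProj_apply, cantorZ, pt]⟩
  · exact ⟨3, by rw [show cantorZ 3 = pt (3 / 4) (3 / 4) from rfl]; norm_num [tiltedProj_apply, pt]⟩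

theorem tiltedProj_mem_Icc {C4 : Set E2} (hc : IsCompact C4)
    (hinv : C4 = ⋃ j : Fin 4, (fun x => (4 : ℝ)⁻¹ • x + cantorZ j) '' C4) {x : E2} (hx : x ∈ C4) :
    tiltedProj x ∈ Set.Icc (0 : ℝ) 3 := by
  have hcov : ∀ y ∈ C4, ∃ x ∈ C4, ∃ t ∈ Set.Icc (0 : ℝ) (9 / 4),
      tiltedProj y = 4⁻¹ * tiltedProj x + t := by
    intro y hy
    rw [hinv] at hy
    obtain ⟨j, x, hx, rfl⟩ := Set.mem_iUnion.1 hy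
    exact ⟨x, hx, _, tiltedProj_cantorZ_mem j, by simp⟩
  constructor
  · obtain ⟨m, hm, hmin⟩ := hc.exists_isMinOn ⟨x, hx⟩ tiltedProj.continuous.continuousOn
    obtain ⟨y, hy, t, ht, he⟩ := hcov m hm
    have h1 : tiltedProj m ≤ tiltedProj y := hmin hy
    have h2 : tiltedProj m ≤ tiltedProj x := hmin hx
    linarith [ht.1]
  · obtain ⟨m, hm, hmax⟩ := hc.exists_isMaxOn ⟨x, hx⟩ tiltedProj.continuous.continuousOn
    obtain ⟨y, hy, t, ht, he⟩ := hcov m hm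
    have h1 : tiltedProj y ≤ tiltedProj m := hmax hy
    have h2 : tiltedProj x ≤ tiltedProj m := hmax hx
    linarith [ht.2]

/-- Every `n < 4 ^ N` is realised by a word of length `N` in the maps of the system, whose
translation projects to `3 n / 4 ^ N`. -/
theorem exists_word {C4 : Set E2}
    (hinv : C4 = ⋃ j : Fin 4, (fun x => (4 : ℝ)⁻¹ • x + cantorZ j) '' C4) (N : ℕ) :
    ∀ n : ℕ, n < 4 ^ N → ∃ z : E2, (∀ x ∈ C4, ((4 : ℝ) ^ N)⁻¹ • x + z ∈ C4) ∧
      tiltedProj z = 3 * n / 4 ^ N := by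
  induction N with
  | zero =>
    intro n hn
    obtain rfl : n = 0 := by simpa using hn
    exact ⟨0, by simp⟩
  | succ N ih =>
    intro n hn
    obtain ⟨w, hw, hwu⟩ := ih (n / 4) (by rw [pow_succ] at hn; omega)
    obtain ⟨j, hj⟩ := exists_tiltedProj_cantorZ (Nat.mod_lt n (by norm_num : 4 > 0))
    refine ⟨((4 : ℝ) ^ N)⁻¹ • cantorZ j + w, fun x hx => ?_, ?_⟩
    · have hjx : (4 : ℝ)⁻¹ • x + cantorZ j ∈ C4 := by
        rw [hinv]
        exact Set.mem_iUnion.2 ⟨j, x, hx, rfl⟩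
      convert! hw _ hjx using 1
      rw [smul_add, smul_smul, pow_succ, mul_inv, add_assoc]
    · have hdm : (n : ℝ) = 4 * (n / 4 : ℕ) + (n % 4 : ℕ) := by 
        exact_mod_cast (Nat.div_add_mod n 4).symm
      rw [map_add, map_smul, hj, hwu, hdm, smul_eq_mul, pow_succ]
      field_simp
      ring

/-- The rotation taking the first coordinate axis to the direction `(1, 2)`. -/
def tiltedRotation : E2 ≃ₗᵢ[ℝ] E2 :=
  LinearIsometry.toLinearIsometryEquiv
    { toFun := fun p => pt ((p 0 - 2 * p 1) / √5) ((2 * p 0 + p 1) / √5)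
      map_add' := fun p q => by ext i; fin_cases i <;> simp [pt] <;> ring
      map_smul' := fun c p => by ext i; fin_cases i <;> simp [pt] <;> ring
      norm_map' := fun p => by
        simp only [EuclideanSpace.norm_eq, LinearMap.coe_mk, AddHom.coe_mk, pt]
        congr 1
        simp [Fin.sum_univ_two, div_pow]
        ring } rfl

theorem tiltedRotation_apply (p : E2) :
    tiltedRotation p = pt ((p 0 - 2 * p 1) / √5) ((2 * p 0 + p 1) / √5) := rfl

theorem exists_isLipGraph {K : Set E2} {M : ℝ}
    (hK : ∀ p ∈ K, ∀ q ∈ K, ‖p - q‖ ≤ M * |tiltedProj p - tiltedProj q|) :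
    ∃ Γ, IsLipGraph Γ (√5 * M) ∧ K ⊆ Γ := by
  have h5 : (0 : ℝ) < √5 := by positivity
  have hs : √5 * √5 = (5 : ℝ) := Real.mul_self_sqrt (by norm_num)
  have hsep : ∀ p ∈ K, ∀ q ∈ K, dist p q ≤
      (√5 * M).toNNReal * dist (tiltedProj p / √5) (tiltedProj q / √5) := by
    intro p hp q hq
    calc dist p q ≤ M * |tiltedProj p - tiltedProj q| := by
          rw [dist_eq_norm]; exact hK p hp q hq
      _ = √5 * M * dist (tiltedProj p / √5) (tiltedProj q / √5) := by
          rw [Real.dist_eq, ← sub_div, abs_div, abs_of_pos h5]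
          field_simp
      _ ≤ _ := by gcongr; exact Real.le_coe_toNNReal _
  set S : E2 → E2 := fun p => tiltedRotation.symm p
  have hinj : Set.InjOn (fun p => tiltedProj p / √5) K := by
    intro p hp q hq h
    have := hsep p hp q hq
    dsimp only at h
    rw [h, dist_self, mul_zero] at this
    exact dist_le_zero.1 this
  set inv := Function.invFunOn (fun p => tiltedProj p / √5) K
  have hinv : ∀ p ∈ K, inv (tiltedProj p / √5) = p := fun p hp => hinj.leftInvOn_invFunOn hp
  have hlip : LipschitzOnWith (√5 * M).toNNReal (fun t => S (inv t) 1)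
      ((fun p => tiltedProj p / √5) '' K) := by
    refine LipschitzOnWith.of_dist_le_mul ?_
    rintro _ ⟨p, hp, rfl⟩ _ ⟨q, hq, rfl⟩
    dsimp only
    rw [hinv p hp, hinv q hq]
    refine le_trans ?_ (hsep p hp q hq)
    rw [← tiltedRotation.symm.dist_map p q, dist_eq_norm, dist_eq_norm]
    exact PiLp.norm_apply_le (S p - S q) 1
  obtain ⟨g, hg, hge⟩ := hlip.extend_real
  refine ⟨_, ⟨Set.univ, g, tiltedRotation, Set.ordConnected_univ, hg.lipschitzOnWith, rfl⟩, ?_⟩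
  intro p hp
  refine ⟨_, ⟨tiltedProj p / √5, trivial, rfl⟩, ?_⟩
  dsimp only
  rw [← hge ⟨p, hp, rfl⟩]
  dsimp only
  rw [hinv p hp]
  have hS : tiltedRotation (S p) = p := tiltedRotation.apply_symm_apply p
  have h0 : S p 0 = tiltedProj p / √5 := by
    rw [tiltedProj_apply]
    nth_rw 2 3 [← hS]
    rw [tiltedRotation_apply]
    simp only [pt]
    simp
    field_simp
    rw [sq, hs]
    ring
  rw [← h0]
  convert! hS using 2
  ext i
  fin_cases i <;> simp [pt]

theorem le_dimH_range_of_separated {E : Type*} [MetricSpace E] {b : ℕ} (hb : 1 < b) {ρ s δ : ℝ}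
    (hρ : 0 < ρ) (hδ : 0 < δ) (hs : 0 < s) (hbρ : (b : ℝ)⁻¹ = ρ ^ s) {P : (ℕ → Fin b) → E}
    (hP : ∀ a a' k, (∀ i < k, a i = a' i) → a k ≠ a' k → δ * ρ ^ k ≤ dist (P a) (P a')) :
    ENNReal.ofReal s ≤ dimH (Set.range P) := by
  have hfirst : ∀ a a' : ℕ → Fin b, a ≠ a' → ∃ k, (∀ i < k, a i = a' i) ∧ a k ≠ a' k := by
    intro a a' h
    have hex : ∃ k, a k ≠ a' k := Function.ne_iff.1 h
    classical
    exact ⟨Nat.find hex, fun i hi => not_not.1 (Nat.find_min hex hi), Nat.find_spec hex⟩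
  have hinj : Function.Injective P := by
    intro a a' h
    by_contra hne
    obtain ⟨k, hk, hk'⟩ := hfirst a a' hne
    have := hP a a' k hk hk'
    rw [h, dist_self] at this
    have : 0 < δ * ρ ^ k := by positivity
    linarith
  have : Nonempty (ℕ → Fin b) := ⟨fun _ => ⟨0, by omega⟩⟩
  set f : E → ℝ := fun p => Real.ofDigits (Function.invFun P p)
  have hf : ∀ a, f (P a) = Real.ofDigits a := fun a => by
    simp only [f, Function.leftInverse_invFun hinj a]
  have hC : 0 ≤ δ⁻¹ ^ s := by positivity
  have hhol : HolderOnWith (δ⁻¹ ^ s).toNNReal s.toNNReal f (Set.range P) := by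
    rintro _ ⟨a, rfl⟩ _ ⟨a', rfl⟩
    rcases eq_or_ne a a' with rfl | hne
    · simp
    obtain ⟨k, hk, hk'⟩ := hfirst a a' hne
    have h1 : dist (f (P a)) (f (P a')) ≤ δ⁻¹ ^ s * dist (P a) (P a') ^ s := by
      rw [hf, hf, Real.dist_eq]
      calc |Real.ofDigits a - Real.ofDigits a'| ≤ ((b : ℝ) ^ k)⁻¹ :=
            Real.abs_ofDigits_sub_ofDigits_le hk
        _ = (ρ ^ k) ^ s := by
            rw [← inv_pow, hbρ, ← Real.rpow_natCast, ← Real.rpow_natCast, ← Real.rpow_mul hρ.le,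
              ← Real.rpow_mul hρ.le, mul_comm]
        _ ≤ (δ⁻¹ * dist (P a) (P a')) ^ s := by
            refine Real.rpow_le_rpow (by positivity) ?_ hs.le
            rw [le_inv_mul_iff₀ hδ]
            exact hP a a' k hk hk'
        _ = _ := Real.mul_rpow (by positivity) dist_nonneg
    rw [edist_dist, edist_dist, Real.coe_toNNReal s hs.le,
      ENNReal.ofReal_rpow_of_nonneg dist_nonneg hs.le, ← ENNReal.ofReal, ← ENNReal.ofReal_mul hC]
    exact ENNReal.ofReal_le_ofReal h1
  have himg : Set.Icc (0 : ℝ) 1 ⊆ f '' Set.range P := by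
    intro t ht
    obtain ⟨a, -, ha⟩ := Real.ofDigits_SurjOn hb ht
    exact ⟨P a, ⟨a, rfl⟩, (hf a).trans ha⟩
  have hone : dimH (Set.Icc (0 : ℝ) 1) = 1 := by
    rw [Real.dimH_of_nonempty_interior (by simp)]
    simp
  have hle := (dimH_mono himg).trans (hhol.dimH_image_le (by simpa using hs))
  rw [hone, ENNReal.le_div_iff_mul_le (by simp [hs]) (by simp), one_mul] at hle
  exact hle

theorem one_sub_le_log_div_log {B : ℝ} (hB : 4 ≤ B) :
    1 - 4 / B ≤ Real.log (B - 2) / Real.log B := by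
  have hlogB : 1 ≤ Real.log B := by
    rw [Real.le_log_iff_exp_le (by linarith)]
    linarith [Real.exp_one_lt_d9]
  have h1 : Real.log B - Real.log (B - 2) ≤ 4 / B := by
    rw [← Real.log_div (by linarith) (by linarith)]
    refine (Real.log_le_sub_one_of_pos (div_pos (by linarith) (by linarith))).trans ?_
    rw [div_sub_one (by linarith), div_le_div_iff₀ (by linarith) (by linarith)]
    nlinarith
  rw [le_div_iff₀ (by linarith)]
  have : 4 / B ≤ 4 / B * Real.log B := le_mul_of_one_le_right (by positivity) hlogB
  linarith

/-- Coding the words of length `N` other than the first and the last in the projection order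
gives a subset of `C4` on which the projection is bi-Lipschitz, of nearly full dimension. -/
theorem exists_biLipschitz_subset {C4 : Set E2} (hc : IsCompact C4) (hne : C4.Nonempty)
    (hinv : C4 = ⋃ j : Fin 4, (fun x => (4 : ℝ)⁻¹ • x + cantorZ j) '' C4) {D : ℝ}
    (hD : ∀ x ∈ C4, ∀ y ∈ C4, ‖x - y‖ ≤ D) (N : ℕ) :
    ∃ K ⊆ C4, (∀ p ∈ K, ∀ q ∈ K,
        ‖p - q‖ ≤ D * (4 ^ (N + 1)) ^ 2 / 6 * |tiltedProj p - tiltedProj q|) ∧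
      ENNReal.ofReal (1 - 4 / 4 ^ (N + 1)) ≤ dimH K := by
  have hB4' : 4 ≤ 4 ^ (N + 1) := by
    rw [pow_succ]; exact Nat.le_mul_of_pos_left 4 (by positivity)
  obtain ⟨b, hb⟩ : ∃ b, 4 ^ (N + 1) = b + 2 := ⟨4 ^ (N + 1) - 2, by omega⟩
  have hb1 : 1 < b := by omega
  set B : ℝ := 4 ^ (N + 1) with hBdef
  have hBb : B = b + 2 := by rw [hBdef]; exact_mod_cast hb
  have hB4 : 4 ≤ B := by rw [hBdef]; exact_mod_cast hB4'
  have hB0 : 0 < B := by linarith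
  have hword : ∀ i : Fin b, ∃ z : E2, (∀ x ∈ C4, B⁻¹ • x + z ∈ C4) ∧
      tiltedProj z = 3 * (i + 1) / B := by
    intro i
    obtain ⟨z, hz, hzu⟩ := exists_word hinv (N + 1) (i + 1) (by have := i.2; omega)
    exact ⟨z, hz, by rw [hzu]; push_cast; rfl⟩
  choose z hz hzu using hword
  obtain ⟨P, hPmem, hP⟩ := exists_coding hc.isClosed hne (r := B⁻¹) (by positivity)
    (inv_lt_one_of_one_lt₀ (by linarith)) z hz
  have hPu : ∀ a, tiltedProj (P a) =
      (tiltedProj (P fun n => a (n + 1)) + 3 * ((a 0 : ℕ) + 1)) / B := by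
    intro a
    rw [hP a, map_add, map_smul, hzu, smul_eq_mul]
    field_simp
  have hrange : ∀ a, 3 / B ≤ tiltedProj (P a) ∧ tiltedProj (P a) ≤ 3 - 3 / B := by
    intro a
    have h := tiltedProj_mem_Icc hc hinv (hPmem fun n => a (n + 1))
    have hab : ((a 0 : ℕ) : ℝ) + 1 ≤ b := by exact_mod_cast (a 0).2
    rw [hPu a]
    constructor
    · gcongr
      have : (0 : ℝ) ≤ (a 0 : ℕ) := by positivity
      linarith [h.1]
    · rw [div_le_iff₀ hB0, sub_mul, div_mul_cancel₀ _ hB0.ne']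
      linarith [h.2]
  have hlt : ∀ a a', a 0 < a' 0 → 6 / B ^ 2 ≤ tiltedProj (P a') - tiltedProj (P a) := by
    intro a a' h
    have h' : ((a 0 : ℕ) : ℝ) + 1 ≤ (a' 0 : ℕ) := by exact_mod_cast h
    rw [hPu a, hPu a', ← sub_div, show 6 / B ^ 2 = (6 / B) / B by field_simp]
    gcongr
    have e1 := (hrange fun n => a (n + 1)).2
    have e2 := (hrange fun n => a' (n + 1)).1
    have : 6 / B = 3 / B + 3 / B := by ring
    linarith
  have hgap : ∀ a a' k, (∀ i < k, a i = a' i) → a k ≠ a' k →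
      6 / B ^ 2 * B⁻¹ ^ k ≤ |tiltedProj (P a) - tiltedProj (P a')| := by
    intro a a' k hk hk'
    rw [← map_sub, coding_sub_coding hP k a a' hk, map_smul, smul_eq_mul, abs_mul,
      abs_of_pos (by positivity : 0 < B⁻¹ ^ k), mul_comm, map_sub]
    gcongr
    rcases lt_or_gt_of_ne hk' with h | h
    · rw [abs_sub_comm]
      exact (hlt (fun n => a (n + k)) (fun n => a' (n + k)) (by simpa using h)).trans
        (le_abs_self _)
    · exact (hlt (fun n => a' (n + k)) (fun n => a (n + k)) (by simpa using h)).trans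
        (le_abs_self _)
  have hD0 : 0 ≤ D := (norm_nonneg _).trans (hD _ hne.some_mem _ hne.some_mem)
  refine ⟨Set.range P, Set.range_subset_iff.2 hPmem, ?_, ?_⟩
  · rintro _ ⟨a, rfl⟩ _ ⟨a', rfl⟩
    by_cases h : ∃ k, a k ≠ a' k
    · classical
      have hk : ∀ i < Nat.find h, a i = a' i := fun i hi => not_not.1 (Nat.find_min h hi)
      have hg := hgap a a' _ hk (Nat.find_spec h)
      set k := Nat.find h
      calc ‖P a - P a'‖ ≤ B⁻¹ ^ k * D := by
            rw [coding_sub_coding hP k a a' hk, norm_smul, Real.norm_of_nonneg (by positivity)]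
            gcongr
            exact hD _ (hPmem _) _ (hPmem _)
        _ = D * B ^ 2 / 6 * (6 / B ^ 2 * B⁻¹ ^ k) := by field_simp
        _ ≤ _ := by gcongr
    · obtain rfl : a = a' := by
        push Not at h
        exact funext h
      simp
  · have hlogB : 0 < Real.log B := Real.log_pos (by linarith)
    refine (ENNReal.ofReal_le_ofReal (one_sub_le_log_div_log hB4)).trans ?_
    refine le_dimH_range_of_separated hb1 (ρ := B⁻¹) (δ := 6 / B ^ 2 / (‖tiltedProj‖ + 1))
      (by positivity) (by positivity) (div_pos (Real.log_pos ?_) hlogB) ?_ ?_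
    · linarith
    · rw [hBb, add_sub_cancel_right, ← hBb, Real.inv_rpow hB0.le,
        Real.rpow_def_of_pos hB0, mul_div_cancel₀ _ hlogB.ne', Real.exp_log (by positivity)]
    · intro a a' k hk hk'
      rw [div_mul_eq_mul_div, div_le_iff₀ (by positivity)]
      refine (hgap a a' k hk hk').trans ?_
      rw [← map_sub, ← Real.norm_eq_abs, dist_eq_norm, mul_comm]
      refine (tiltedProj.le_opNorm _).trans ?_
      gcongr
      linarith

/-- There is a universal constant `c > 0` so that for every `ε ∈ (0,1)` there is a Lipschitz
graph `Γ` with `dim (𝒞₄ ∩ Γ) ≥ 1 − ε` and `Lip(Γ) ≤ c·ε⁻²`, where `𝒞₄` is the 4-corner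
Cantor set (the attractor of the IFS `x ↦ x/4 + z_j`). -/
theorem statement5 (C4 : Set E2) (hc : IsCompact C4) (hne : C4.Nonempty)
    (hinv : C4 = ⋃ j : Fin 4, (fun x => (4 : ℝ)⁻¹ • x + cantorZ j) '' C4) :
    ∃ c : ℝ, 0 < c ∧ ∀ ε : ℝ, ε ∈ Set.Ioo (0 : ℝ) 1 →
      ∃ Γ : Set E2, IsLipGraph Γ (c * (ε ^ 2)⁻¹) ∧
        ENNReal.ofReal (1 - ε) ≤ dimH (C4 ∩ Γ) := by
  obtain ⟨D, hD⟩ : ∃ D, ∀ x ∈ C4, ∀ y ∈ C4, ‖x - y‖ ≤ D :=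
    ⟨Metric.diam C4, fun x hx y hy => by
      rw [← dist_eq_norm]; exact Metric.dist_le_diam_of_mem hc.isBounded hx hy⟩
  have hD0 : 0 ≤ D := (norm_nonneg _).trans (hD _ hne.some_mem _ hne.some_mem)
  refine ⟨√5 * (D * 16 ^ 2 / 6) + 1, by positivity, fun ε ⟨hε0, hε1⟩ => ?_⟩
  obtain ⟨N, hN1, hN2⟩ := exists_nat_pow_near (x := 4 / ε) (y := (4 : ℝ))
    (by rw [one_le_div₀ hε0]; linarith) (by norm_num)
  obtain ⟨K, hKC, hK, hdim⟩ := exists_biLipschitz_subset hc hne hinv hD N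
  have hB : (4 : ℝ) ^ (N + 1) ≤ 16 / ε := by
    rw [pow_succ, show 16 / ε = 4 / ε * 4 by ring]
    gcongr
  obtain ⟨Γ, ⟨I, g, R, hI, hg, hΓ⟩, hKΓ⟩ := exists_isLipGraph hK
  refine ⟨Γ, ⟨I, g, R, hI, hg.weaken (Real.toNNReal_le_toNNReal ?_), hΓ⟩, ?_⟩
  · calc √5 * (D * (4 ^ (N + 1)) ^ 2 / 6) ≤ √5 * (D * (16 / ε) ^ 2 / 6) := by gcongr
      _ = √5 * (D * 16 ^ 2 / 6) * (ε ^ 2)⁻¹ := by rw [div_pow]; ring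
      _ ≤ _ := by gcongr; linarith
  · refine le_trans (ENNReal.ofReal_le_ofReal ?_)
      (hdim.trans (dimH_mono (Set.subset_inter hKC hKΓ)))
    have : 4 / (4 : ℝ) ^ (N + 1) ≤ ε := by
      rw [div_le_iff₀ (by positivity), mul_comm, ← div_le_iff₀ hε0]
      exact hN2.le
    linarith
end
end

section
/- Let K ⊆ ℝ^d be a compact convex set with ν := inf{|P_θ(K)| : θ ∈ S^{d-1}} > 0, where P_θ is the orthogonal projection onto the line spanned by θ and |·| is one-dimensional Lebesgue measure. Then there exists a closed ball B of diameter ν/d such that B ⊆ K. -/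
open Set MeasureTheory Metric Real
open scoped ENNReal NNReal RealInnerProductSpace

noncomputable section

/-- Minkowski's asymmetry bound: a nonempty compact convex set of a `d`-dimensional space contains
a point `x` such that the reflection of the set through `x`, shrunk by the factor `1 / d`, stays
inside the set. -/
theorem exists_forall_exists_smul_eq_smul_add {E : Type*} [NormedAddCommGroup E] [NormedSpace ℝ E]
    [FiniteDimensional ℝ E] {K : Set E} (hKc : IsCompact K) (hKconv : Convex ℝ K)
    (hne : K.Nonempty) {d : ℕ} (hd : 0 < d) (hE : Module.finrank ℝ E = d) :
    ∃ x : E, ∀ y ∈ K, ∃ k ∈ K, ((d : ℝ) + 1) • x = (d : ℝ) • k + y := by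
  have hd' : (0 : ℝ) < d := by exact_mod_cast hd
  have hd1 : (d : ℝ) + 1 ≠ 0 := by positivity
  let φ : E → E →ᵃ[ℝ] E := fun y => AffineMap.homothety y ((d : ℝ) / (d + 1))
  have hφ : ∀ y k, ((d : ℝ) + 1) • φ y k = (d : ℝ) • k + y := by
    intro y k
    simp only [φ, AffineMap.homothety_apply, vsub_eq_sub, vadd_eq_add, smul_add, smul_smul]
    rw [mul_div_cancel₀ _ hd1]
    module
  obtain ⟨x, hx⟩ : (⋂ y : K, φ y '' K).Nonempty := by
    refine Convex.helly_theorem_compact' (𝕜 := ℝ) (fun y => hKconv.affine_image _)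
      (fun y => hKc.image (φ y).continuous_of_finiteDimensional) fun I hI => ?_
    obtain ⟨k₀, hk₀⟩ := hne
    obtain ⟨f⟩ : Nonempty (I ↪ Fin (d + 1)) :=
      Function.Embedding.nonempty_of_card_le (by simpa [hE] using hI)
    let g : Fin (d + 1) → K := Function.extend f (fun i => (i : K)) fun _ => ⟨k₀, hk₀⟩
    have hg : ∀ i : I, g (f i) = i := fun i => f.injective.extend_apply _ _ i
    refine ⟨((d : ℝ) + 1)⁻¹ • ∑ j, (g j : E), mem_iInter₂.2 fun i hi => ?_⟩
    let j := f ⟨i, hi⟩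
    have hj : g j = i := hg ⟨i, hi⟩
    refine ⟨∑ l ∈ Finset.univ.erase j, (d : ℝ)⁻¹ • (g l : E), ?_, ?_⟩
    · refine hKconv.sum_mem (fun _ _ => by positivity) ?_ fun l _ => (g l).2
      simp [Finset.card_erase_of_mem, hd'.ne']
    · refine smul_right_injective E hd1 ?_
      simp only [hφ]
      rw [← Finset.smul_sum, smul_inv_smul₀ hd'.ne', smul_inv_smul₀ hd1, ← hj,
        Finset.sum_erase_add _ _ (Finset.mem_univ j)]
  refine ⟨x, fun y hy => ?_⟩
  obtain ⟨k, hk, rfl⟩ := mem_iInter.1 hx ⟨y, hy⟩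
  exact ⟨k, hk, hφ y k⟩

/-- A point outside a closed convex set is strictly separated from it by a unit vector. -/
theorem exists_norm_eq_one_forall_inner_lt {E : Type*} [NormedAddCommGroup E]
    [InnerProductSpace ℝ E] [CompleteSpace E] {K : Set E} (hKc : IsClosed K)
    (hKconv : Convex ℝ K) (hne : K.Nonempty) {p : E} (hp : p ∉ K) :
    ∃ θ : E, ‖θ‖ = 1 ∧ ∀ a ∈ K, ⟪θ, a⟫ < ⟪θ, p⟫ := by
  obtain ⟨f, u, hf, hu⟩ := geometric_hahn_banach_closed_point hKconv hKc hp
  let v := (InnerProductSpace.toDual ℝ E).symm f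
  have hv : ∀ y, ⟪v, y⟫ = f y := fun y => InnerProductSpace.toDual_symm_apply
  have hlt : ∀ a ∈ K, ⟪v, a⟫ < ⟪v, p⟫ := fun a ha => by
    rw [hv, hv]; exact (hf a ha).trans hu
  have hv0 : v ≠ 0 := by
    intro h
    obtain ⟨a, ha⟩ := hne
    simpa [h] using hlt a ha
  refine ⟨‖v‖⁻¹ • v, norm_smul_inv_norm (𝕜 := ℝ) hv0, fun a ha => ?_⟩
  simp only [real_inner_smul_left]
  exact mul_lt_mul_of_pos_left (hlt a ha) (by positivity)

/-- John ellipsoid lemma: if `K ⊆ ℝ^d` is a compact convex set with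
`ν = inf{|P_θ(K)| : θ ∈ S^{d-1}} > 0`, then `K` contains a closed ball of diameter `ν/d`. -/
theorem statement7 (d : ℕ) (hd : 0 < d) (K : Set (EuclideanSpace ℝ (Fin d)))
    (hKc : IsCompact K) (hKconv : Convex ℝ K) (ν : ℝ)
    (hν : ν = ⨅ θ : Metric.sphere (0 : EuclideanSpace ℝ (Fin d)) 1,
      (volume ((fun z => ⟪(θ : EuclideanSpace ℝ (Fin d)), z⟫) '' K)).toReal)
    (hν0 : 0 < ν) :
    ∃ x : EuclideanSpace ℝ (Fin d), Metric.closedBall x (ν / (2 * d)) ⊆ K := by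
  have hd' : (1 : ℝ) ≤ d := by exact_mod_cast hd
  have hwidth : ∀ θ : EuclideanSpace ℝ (Fin d), ‖θ‖ = 1 →
      ν ≤ (volume ((fun z => ⟪θ, z⟫) '' K)).toReal := by
    intro θ hθ
    rw [hν]
    exact ciInf_le (f := fun θ : Metric.sphere (0 : EuclideanSpace ℝ (Fin d)) 1 =>
      (volume ((fun z => ⟪(θ : EuclideanSpace ℝ (Fin d)), z⟫) '' K)).toReal)
      ⟨0, by rintro _ ⟨θ, rfl⟩; exact ENNReal.toReal_nonneg⟩ ⟨θ, by simpa using hθ⟩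
  have hne : K.Nonempty := by
    rw [nonempty_iff_ne_empty]
    rintro rfl
    simp at hν
    exact hν0.ne' hν
  obtain ⟨x, hx⟩ := exists_forall_exists_smul_eq_smul_add hKc hKconv hne hd
    finrank_euclideanSpace_fin
  refine ⟨x, fun p hp => ?_⟩
  by_contra hpK
  obtain ⟨θ, hθ, hlt⟩ := exists_norm_eq_one_forall_inner_lt hKc.isClosed hKconv hne hpK
  have hcont : ContinuousOn (fun z => ⟪θ, z⟫) K := by fun_prop
  obtain ⟨a, ha, hmin⟩ := hKc.exists_isMinOn hne hcont
  obtain ⟨b, hb, hmax⟩ := hKc.exists_isMaxOn hne hcont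
  have hab : ν ≤ ⟪θ, b⟫ - ⟪θ, a⟫ := by
    have hsub : (fun z => ⟪θ, z⟫) '' K ⊆ Icc ⟪θ, a⟫ ⟪θ, b⟫ := by
      rintro _ ⟨z, hz, rfl⟩
      exact ⟨hmin hz, hmax hz⟩
    calc ν ≤ (volume ((fun z => ⟪θ, z⟫) '' K)).toReal := hwidth θ hθ
      _ ≤ (volume (Icc ⟪θ, a⟫ ⟪θ, b⟫)).toReal :=
        ENNReal.toReal_mono (by simp) (measure_mono hsub)
      _ = ⟪θ, b⟫ - ⟪θ, a⟫ := by
        rw [Real.volume_Icc, ENNReal.toReal_ofReal (sub_nonneg.2 (hmin hb))]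
  obtain ⟨k, hk, hxk⟩ := hx a ha
  have hinner : ((d : ℝ) + 1) * ⟪θ, x⟫ = d * ⟪θ, k⟫ + ⟪θ, a⟫ := by
    simpa only [inner_add_right, real_inner_smul_right] using congrArg (fun z => ⟪θ, z⟫) hxk
  have hkb : ⟪θ, k⟫ ≤ ⟪θ, b⟫ := hmax hk
  have hpx : ⟪θ, p⟫ - ⟪θ, x⟫ ≤ ν / (2 * d) := by
    rw [← inner_sub_right]
    calc ⟪θ, p - x⟫ ≤ ‖θ‖ * ‖p - x‖ := real_inner_le_norm _ _
      _ ≤ ν / (2 * d) := by rw [hθ, one_mul, ← dist_eq_norm]; exact hp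
  have hrad : ((d : ℝ) + 1) * (ν / (2 * d)) ≤ ν := by
    rw [mul_div_assoc', div_le_iff₀ (by positivity)]
    nlinarith
  nlinarith [hlt b hb]
end
end

section
/- Let {f_j}_{j=1}^N, f_j(x) = r_j x + z_j with r_j ∈ (0,1) and z_j ∈ ℝ², be a rotation-free iterated function system with attractor C, and let x_j = z_j/(1 − r_j) be the fixed point of f_j. Then the convex hull of C equals the convex hull of the finite set {x_1, …, x_N}. -/
open Set MeasureTheory Metric Real
open scoped ENNReal NNReal

noncomputable section

section Homothety

variable {E : Type*} [NormedAddCommGroup E] [NormedSpace ℝ E]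

theorem smul_inv_one_sub_add {r : ℝ} (hr : r < 1) (x z : E) :
    r • x + z = r • x + (1 - r) • ((1 - r)⁻¹ • z) := by
  rw [smul_inv_smul₀ (sub_pos.2 hr).ne']

/-- A nonempty compact set mapped into itself by a contracting homothety contains the centre of
the homothety. -/
theorem IsCompact.homothety_center_mem {C : Set E} (hC : IsCompact C) (hne : C.Nonempty)
    {r : ℝ} (hr : r ∈ Ioo (0 : ℝ) 1) {z : E} (h : ∀ x ∈ C, r • x + z ∈ C) :
    (1 - r)⁻¹ • z ∈ C := by
  set p := (1 - r)⁻¹ • z with hp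
  obtain ⟨c, hc, hmin⟩ := hC.exists_isMinOn hne
    (f := fun x => ‖x - p‖) (by fun_prop)
  have hle : ‖c - p‖ ≤ ‖r • c + z - p‖ := hmin (h c hc)
  have heq : r • c + z - p = r • (c - p) := by
    rw [smul_inv_one_sub_add hr.2, ← hp]
    module
  rw [heq, norm_smul, Real.norm_of_nonneg hr.1.le] at hle
  have hzero : ‖c - p‖ = 0 := by nlinarith [norm_nonneg (c - p), hr.2]
  rwa [← sub_eq_zero.1 (norm_eq_zero.1 hzero)]

/-- A compact set covered by its images under finitely many contracting homotheties lies in the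
convex hull of their centres. -/
theorem IsCompact.subset_convexHull_homothety_centers {ι : Type*} [Finite ι] {C : Set E}
    (hC : IsCompact C) {r : ι → ℝ} (hr : ∀ j, r j < 1) (hr0 : ∀ j, 0 ≤ r j) {z : ι → E}
    (h : ∀ y ∈ C, ∃ j, ∃ x ∈ C, r j • x + z j = y) :
    C ⊆ convexHull ℝ (range fun j => (1 - r j)⁻¹ • z j) := by
  intro y hy
  by_contra hyD
  obtain ⟨g, u, hgu, huy⟩ := geometric_hahn_banach_closed_point (convex_convexHull ℝ _)
    ((finite_range fun j => (1 - r j)⁻¹ • z j).isClosed_convexHull ℝ) hyD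
  obtain ⟨m, hm, hmax⟩ := hC.exists_isMaxOn ⟨y, hy⟩ g.continuous.continuousOn
  obtain ⟨j, x, hx, rfl⟩ := h m hm
  have hxm : g x ≤ g (r j • x + z j) := hmax hx
  have hym : g y ≤ g (r j • x + z j) := hmax hy
  have hj := hgu _ (subset_convexHull ℝ _ (mem_range_self j))
  rw [smul_inv_one_sub_add (hr j), map_add, map_smul, map_smul, smul_eq_mul, smul_eq_mul]
    at hxm hym
  nlinarith [hr j, hr0 j]

end Homothety

/-- For a rotation-free IFS `f_j(x) = r_j x + z_j` with attractor `C` and fixed points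
`x_j = (1 − r_j)⁻¹ z_j`, the convex hull of `C` equals the convex hull of `{x_1, …, x_N}`. -/
theorem statement8 (N : ℕ) (hN : 0 < N) (r : Fin N → ℝ) (z : Fin N → E2)
    (f : Fin N → E2 → E2)
    (hr : ∀ j, r j ∈ Set.Ioo (0 : ℝ) 1)
    (hf : ∀ j x, f j x = r j • x + z j)
    (C : Set E2) (hCc : IsCompact C) (hCne : C.Nonempty)
    (hCinv : C = ⋃ j, f j '' C) :
    convexHull ℝ C = convexHull ℝ (Set.range fun j => (1 - r j)⁻¹ • z j) := by
  apply Subset.antisymm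
  · refine convexHull_min (hCc.subset_convexHull_homothety_centers (fun j => (hr j).2)
      (fun j => (hr j).1.le) fun y hy => ?_) (convex_convexHull ℝ _)
    rw [hCinv] at hy
    obtain ⟨j, x, hx, rfl⟩ := mem_iUnion.1 hy
    exact ⟨j, x, hx, (hf j x).symm⟩
  · refine convexHull_mono (range_subset_iff.2 fun j =>
      hCc.homothety_center_mem hCne (hr j) fun x hx => ?_)
    rw [← hf, hCinv]
    exact mem_iUnion.2 ⟨j, x, hx, rfl⟩
end
end

section
/- Let {v_n}_{n≥1} ⊆ ℕ be a sequence of positive integers and for each n let Σ_n = {(w_1,…,w_n) : 1 ≤ w_j ≤ v_j for 1 ≤ j ≤ n}. Let b ∈ (0,1) and let {K(w) : w ∈ Σ_n, n ∈ ℕ} be a collection of compact convex subsets of ℝ^d satisfying: (a) K(w_1⋯w_n) ⊇ K(w_1⋯w_n w_{n+1}) for every (w_1⋯w_n w_{n+1}) ∈ Σ_{n+1}; (b) the interiors of K(w) and K(w′) are disjoint for distinct w, w′ ∈ Σ_n; (c) D_n := max_{w∈Σ_n} diam(K(w)) → 0 as n → ∞; (d) d_n := min_{w∈Σ_n} diam(K(w))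 satisfies d_n/D_n > b for all n; (e) inf{|P_θ(K(w))| : θ ∈ S^{d-1}} ≥ b·d_n for every w ∈ Σ_n. Then the set E = ⋂_{n≥1} ⋃_{w∈Σ_n} K(w) satisfies dim(E) ≥ liminf_{n→∞} log(v_1 v_2 ⋯ v_{n-1}) / (−log d_n). -/
open Set MeasureTheory Metric Real Filter
open scoped ENNReal NNReal RealInnerProductSpace

noncomputable section

/-- A word `w = (w_1, …, w_n)` is valid (belongs to `Σ_n`) if `1 ≤ w_j ≤ v_j` for all `j`
(here `v i` plays the role of `v_{i+1}`). -/
def validWord (v : ℕ → ℕ) {n : ℕ} (w : Fin n → ℕ) : Prop :=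
  ∀ i : Fin n, 1 ≤ w i ∧ w i ≤ v i

lemma exists_norm_eq_one_forall_inner_eq_zero {d : ℕ} (e : ℕ → EuclideanSpace ℝ (Fin d)) {k : ℕ}
    (hk : k < d) : ∃ θ : EuclideanSpace ℝ (Fin d), ‖θ‖ = 1 ∧ ∀ j < k, ⟪θ, e j⟫ = 0 := by
  set U := Submodule.span ℝ (((Finset.range k).image e : Finset (EuclideanSpace ℝ (Fin d))) :
    Set (EuclideanSpace ℝ (Fin d))) with hU
  have hfin : Module.finrank ℝ U < d :=
    ((finrank_span_finset_le_card _).trans (Finset.card_image_le.trans (by simp))).trans_lt hk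
  have hbot : Uᗮ ≠ ⊥ := by
    intro h
    rw [Submodule.orthogonal_eq_bot_iff] at h
    rw [h] at hfin
    simp at hfin
  obtain ⟨x, hx, hx0⟩ := Submodule.exists_mem_ne_zero_of_ne_bot hbot
  refine ⟨‖x‖⁻¹ • x, norm_smul_inv_norm hx0, fun j hj => ?_⟩
  have hj : e j ∈ U := Submodule.subset_span (by simpa using ⟨j, hj, rfl⟩)
  rw [real_inner_smul_left, Submodule.inner_left_of_mem_orthogonal hj hx, mul_zero]

/-- In a set of width at least `h`, every point has a point at distance at least `h / 4` from it
in any prescribed direction. -/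
lemma exists_le_abs_inner_sub {d : ℕ} {K : Set (EuclideanSpace ℝ (Fin d))} {h : ℝ} (hh : 0 < h)
    {θ : EuclideanSpace ℝ (Fin d)}
    (hw : h ≤ (volume ((fun z => ⟪θ, z⟫) '' K)).toReal) (p : EuclideanSpace ℝ (Fin d)) :
    ∃ x ∈ K, h / 4 ≤ |⟪θ, x - p⟫| := by
  by_contra! hcon
  have hsub : (fun z => ⟪θ, z⟫) '' K ⊆ closedBall ⟪θ, p⟫ (h / 4) := by
    rintro _ ⟨x, hx, rfl⟩
    rw [mem_closedBall, Real.dist_eq, ← inner_sub_right]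
    exact (hcon x hx).le
  have hle := ENNReal.toReal_mono measure_closedBall_lt_top.ne
    (measure_mono (μ := volume) hsub)
  rw [Real.volume_closedBall, ENNReal.toReal_ofReal (by positivity)] at hle
  linarith

lemma exists_triangular_system {d : ℕ} {K : Set (EuclideanSpace ℝ (Fin d))} {h : ℝ} (hh : 0 < h)
    (hw : ∀ θ : EuclideanSpace ℝ (Fin d), ‖θ‖ = 1 →
      h ≤ (volume ((fun z => ⟪θ, z⟫) '' K)).toReal)
    (p : EuclideanSpace ℝ (Fin d)) {k : ℕ} (hk : k ≤ d) :
    ∃ e θ : ℕ → EuclideanSpace ℝ (Fin d), ∀ i < k,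
      p + e i ∈ K ∧ ‖θ i‖ = 1 ∧ (∀ j < i, ⟪θ i, e j⟫ = 0) ∧ h / 4 ≤ |⟪θ i, e i⟫| := by
  induction k with
  | zero => exact ⟨0, 0, by simp⟩
  | succ k ih =>
    obtain ⟨e, θ, H⟩ := ih (by omega)
    obtain ⟨η, hη, hηe⟩ := exists_norm_eq_one_forall_inner_eq_zero e (k := k) (by omega)
    obtain ⟨x, hx, hxη⟩ := exists_le_abs_inner_sub hh (hw η hη) p
    refine ⟨Function.update e k (x - p), Function.update θ k η, fun i hi => ?_⟩
    have hlow : ∀ j < k, Function.update e k (x - p) j = e j := fun j hj =>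
      Function.update_of_ne hj.ne _ _
    rcases (Nat.lt_succ_iff.1 hi).eq_or_lt with rfl | hik
    · simp only [Function.update_self, add_sub_cancel]
      exact ⟨hx, hη, fun j hj => by rw [hlow j hj, hηe j hj], hxη⟩
    · obtain ⟨h1, h2, h3, h4⟩ := H i hik
      rw [hlow i hik, Function.update_of_ne hik.ne]
      exact ⟨h1, h2, fun j hj => by rw [hlow j (hj.trans hik), h3 j hj], h4⟩

lemma ofReal_pow_le_volume_parallelepiped {d : ℕ} {r : ℝ} (hr : 0 ≤ r)
    (e θ : Fin d → EuclideanSpace ℝ (Fin d)) (hθ : ∀ i, ‖θ i‖ = 1)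
    (htri : ∀ i j, j < i → ⟪θ i, e j⟫ = 0) (hdiag : ∀ i, r ≤ |⟪θ i, e i⟫|) :
    ENNReal.ofReal (r ^ d) ≤ volume (parallelepiped e) := by
  have : Fact (Module.finrank ℝ (EuclideanSpace ℝ (Fin d)) = d) := ⟨by simp⟩
  let b := EuclideanSpace.basisFun (Fin d) ℝ
  let o := b.toBasis.orientation
  rw [← o.measure_eq_volume, AlternatingMap.measure_parallelepiped]
  refine ENNReal.ofReal_le_ofReal ?_
  have hmat : (b.toBasis.toMatrix θ).transpose * b.toBasis.toMatrix e =
      Matrix.of fun i j => ⟪θ i, e j⟫ := by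
    ext i j
    simp [Matrix.mul_apply, Module.Basis.toMatrix_apply, b, PiLp.inner_apply, mul_comm]
  have hdet := congrArg Matrix.det hmat
  rw [Matrix.det_mul, Matrix.det_transpose,
    Matrix.det_of_isUpperTriangular (M := Matrix.of fun i j => ⟪θ i, e j⟫)
      (fun i j hij => htri i j hij)] at hdet
  have hθ1 : |(b.toBasis.toMatrix θ).det| ≤ 1 := by
    have := o.abs_volumeForm_apply_le θ
    rw [o.volumeForm_robust' b] at this
    simpa [hθ, Module.Basis.det_apply] using this
  calc r ^ d = ∏ _i : Fin d, r := by simp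
    _ ≤ ∏ i, |⟪θ i, e i⟫| := Finset.prod_le_prod (fun _ _ => hr) fun i _ => hdiag i
    _ = |(b.toBasis.toMatrix θ).det| * |(b.toBasis.toMatrix e).det| := by
      rw [← abs_mul, hdet, Finset.abs_prod]; rfl
    _ ≤ 1 * |(b.toBasis.toMatrix e).det| := by gcongr
    _ = |o.volumeForm e| := by rw [one_mul, o.volumeForm_robust' b, Module.Basis.det_apply]

/-- A convex set of width at least `h` in every direction has volume at least `(h / (4 d)) ^ d`. -/
lemma ofReal_pow_le_volume_of_width {d : ℕ} (hd : 0 < d) {K : Set (EuclideanSpace ℝ (Fin d))}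
    (hK : Convex ℝ K) {h : ℝ} (hh : 0 < h)
    (hw : ∀ θ : EuclideanSpace ℝ (Fin d), ‖θ‖ = 1 →
      h ≤ (volume ((fun z => ⟪θ, z⟫) '' K)).toReal)
    {p : EuclideanSpace ℝ (Fin d)} (hp : p ∈ K) :
    ENNReal.ofReal ((h / (4 * d)) ^ d) ≤ volume K := by
  obtain ⟨e, θ, H⟩ := exists_triangular_system hh hw p le_rfl
  have hd' : (0 : ℝ) < d := by exact_mod_cast hd
  refine (ofReal_pow_le_volume_parallelepiped (by positivity)
    (fun i : Fin d => (d : ℝ)⁻¹ • e i) (fun i : Fin d => θ i) (fun i => (H i i.2).2.1)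
    (fun i j hij => ?_) fun i => ?_).trans ?_
  · rw [real_inner_smul_right, (H i i.2).2.2.1 j hij, mul_zero]
  · rw [real_inner_smul_right, abs_mul, abs_of_pos (inv_pos.2 hd')]
    calc h / (4 * d) = (d : ℝ)⁻¹ * (h / 4) := by field_simp
      _ ≤ _ := by gcongr; exact (H i i.2).2.2.2
  · rw [← measure_preimage_add volume p K]
    refine measure_mono fun x hx => ?_
    obtain ⟨t, ht, rfl⟩ := (mem_parallelepiped_iff _ _).1 hx
    have hmem : ∀ i : Fin d, p + t i • e i ∈ K := fun i => by
      have := hK.add_smul_mem hp (H i i.2).1 (t := t i) ⟨ht.1 i, ht.2 i⟩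
      exact this
    have := hK.sum_mem (t := Finset.univ) (w := fun _ : Fin d => (d : ℝ)⁻¹)
      (fun _ _ => by positivity) (by simp [hd'.ne']) fun i _ => hmem i
    have heq : ∑ i : Fin d, (d : ℝ)⁻¹ • (p + t i • e i) =
        p + ∑ i : Fin d, t i • ((d : ℝ)⁻¹ • e i) := by
      simp only [smul_add, Finset.sum_add_distrib, Finset.sum_const, Finset.card_univ,
        Fintype.card_fin, ← Nat.cast_smul_eq_nsmul ℝ, smul_smul, mul_inv_cancel₀ hd'.ne', one_smul]
      simp only [mul_comm]
    rwa [heq] at this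

lemma card_mul_le_of_interior_disjoint {d : ℕ} (hd : 0 < d) {ι : Type*} {T : Finset ι}
    {A : ι → Set (EuclideanSpace ℝ (Fin d))} {h R : ℝ} {x : EuclideanSpace ℝ (Fin d)}
    (hh : 0 < h) (hR : 0 ≤ R) (hne : ∀ i ∈ T, (A i).Nonempty) (hA : ∀ i ∈ T, Convex ℝ (A i))
    (hw : ∀ i ∈ T, ∀ θ : EuclideanSpace ℝ (Fin d), ‖θ‖ = 1 →
      h ≤ (volume ((fun z => ⟪θ, z⟫) '' A i)).toReal)
    (hdisj : ∀ i ∈ T, ∀ j ∈ T, i ≠ j → interior (A i) ∩ interior (A j) = ∅)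
    (hsub : ∀ i ∈ T, A i ⊆ closedBall x R) :
    (T.card : ℝ) * (h / (4 * d)) ^ d ≤
      R ^ d * (volume (ball (0 : EuclideanSpace ℝ (Fin d)) 1)).toReal := by
  have key : (T.card : ℝ≥0∞) * ENNReal.ofReal ((h / (4 * d)) ^ d) ≤ volume (closedBall x R) :=
    calc (T.card : ℝ≥0∞) * ENNReal.ofReal ((h / (4 * d)) ^ d)
        = ∑ _i ∈ T, ENNReal.ofReal ((h / (4 * d)) ^ d) := by simp
      _ ≤ ∑ i ∈ T, volume (interior (A i)) := Finset.sum_le_sum fun i hi => by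
          rw [measure_interior_of_null_frontier ((hA i hi).addHaar_frontier volume)]
          exact ofReal_pow_le_volume_of_width hd (hA i hi) hh (hw i hi) (hne i hi).some_mem
      _ = volume (⋃ i ∈ T, interior (A i)) := by
          refine (measure_biUnion_finset (fun i hi j hj hij => ?_)
            fun i _ => isOpen_interior.measurableSet).symm
          exact disjoint_iff_inter_eq_empty.2 (hdisj i hi j hj hij)
      _ ≤ volume (closedBall x R) :=
          measure_mono (iUnion₂_subset fun i hi => interior_subset.trans (hsub i hi))
  have := ENNReal.toReal_mono measure_closedBall_lt_top.ne key
  rw [Measure.addHaar_closedBall _ _ hR, ENNReal.toReal_mul, ENNReal.toReal_mul,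
    ENNReal.toReal_ofReal (by positivity), ENNReal.toReal_ofReal (by positivity)] at this
  simpa using this

/-- A form of the mass distribution principle along a sequence of scales `δ n`. -/
lemma le_dimH_of_measure_le {X : Type*} [MetricSpace X] [MeasurableSpace X] [BorelSpace X]
    {μ : Measure X} {E : Set X} (hE : μ E ≠ 0) {δ V : ℕ → ℝ} {C : ℝ} (hC : 0 < C) {n₀ : ℕ}
    {s : ℝ≥0} (hs : 0 < s) (hδ : ∀ n, n₀ ≤ n → 0 < δ n) (hδ0 : Tendsto δ atTop (nhds 0))
    (hμ : ∀ n, n₀ ≤ n → ∀ S : Set X, ediam S ≤ ENNReal.ofReal (δ n) →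
      μ S ≤ ENNReal.ofReal (C * (V n)⁻¹))
    (hV : ∀ n, n₀ ≤ n → (V n)⁻¹ ≤ δ (n + 1) ^ (s : ℝ)) : (s : ℝ≥0∞) ≤ dimH E := by
  have hs' : (0 : ℝ) < s := hs
  have hμ' : ∀ n, n₀ ≤ n → ∀ S : Set X, ediam S ≤ ENNReal.ofReal (δ n) →
      μ S ≤ ENNReal.ofReal (C * δ (n + 1) ^ (s : ℝ)) := fun n hn S hS =>
    (hμ n hn S hS).trans (ENNReal.ofReal_le_ofReal (by gcongr; exact hV n hn))
  have hle : (ENNReal.ofReal C)⁻¹ • μ ≤ μH[s] := by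
    refine Measure.le_hausdorffMeasure _ _ (ENNReal.ofReal (δ n₀ / 2))
      (by simpa using hδ n₀ le_rfl) fun S hS => ?_
    rw [Measure.smul_apply, smul_eq_mul, mul_comm, ← div_eq_mul_inv]
    refine ENNReal.div_le_of_le_mul' ?_
    rcases eq_or_ne (ediam S) 0 with h0 | h0
    · have hlim : Tendsto (fun n => ENNReal.ofReal (C * δ (n + 1) ^ (s : ℝ))) atTop (nhds 0) := by
        have h1 := ((hδ0.comp (tendsto_add_atTop_nat 1)).rpow_const
          (p := (s : ℝ)) (Or.inr hs'.le)).const_mul C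
        rw [Real.zero_rpow hs'.ne', mul_zero] at h1
        simpa using ENNReal.tendsto_ofReal h1
      refine (ge_of_tendsto hlim ?_).trans zero_le
      filter_upwards [eventually_ge_atTop n₀] with n hn
      exact hμ' n hn S (by simp [h0])
    · have htop : ediam S ≠ ∞ := (hS.trans_lt ENNReal.ofReal_lt_top).ne
      have hr : 0 < (ediam S).toReal := ENNReal.toReal_pos h0 htop
      have hex : ∃ m, δ (n₀ + m) ≤ (ediam S).toReal := by
        have h2 : Tendsto (fun m => δ (n₀ + m)) atTop (nhds 0) := by
          simpa only [add_comm] using (tendsto_add_atTop_iff_nat n₀).2 hδ0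
        exact ((h2.eventually (gt_mem_nhds hr)).exists).imp fun _ h => h.le
      classical
      obtain ⟨k, hk⟩ : ∃ k, Nat.find hex = k + 1 := by
        refine Nat.exists_eq_succ_of_ne_zero fun hzero => ?_
        have h3 := Nat.find_spec hex
        rw [hzero, add_zero] at h3
        have h4 := ENNReal.toReal_le_of_le_ofReal (by linarith [hδ n₀ le_rfl]) hS
        linarith [hδ n₀ le_rfl]
      have h5 := Nat.find_spec hex
      have h6 := Nat.find_min hex (m := k) (by omega)
      rw [hk] at h5
      have h7 : ediam S ≤ ENNReal.ofReal (δ (n₀ + k)) := by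
        rw [← ENNReal.ofReal_toReal htop]
        exact ENNReal.ofReal_le_ofReal (not_le.1 h6).le
      refine (hμ' _ (by omega) S h7).trans ?_
      rw [ENNReal.ofReal_mul hC.le]
      gcongr
      rw [← ENNReal.ofReal_rpow_of_pos (hδ _ (by omega))]
      gcongr
      exact ENNReal.ofReal_le_of_le_toReal h5
  refine le_dimH_of_hausdorffMeasure_ne_zero fun hzero => hE ?_
  have := (hle E).trans_eq hzero
  simpa using this

lemma infinitePi_uniformOn_cylinder_le {v : ℕ → ℕ} [∀ i, NeZero (v i)] {n : ℕ} (w : Fin n → ℕ) :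
    Measure.infinitePi (fun i => ProbabilityTheory.uniformOn (univ : Set (Fin (v i))))
        {ω | (fun i : Fin n => (ω i : ℕ) + 1) = w} ≤
      ENNReal.ofReal (∏ i ∈ Finset.range n, (v i : ℝ))⁻¹ := by
  classical
  let w' : ℕ → ℕ := fun i => if h : i < n then w ⟨i, h⟩ else 0
  have hset : {ω : (i : ℕ) → Fin (v i) | (fun i : Fin n => (ω i : ℕ) + 1) = w} ⊆
      Set.pi (Finset.range n) fun i => {x : Fin (v i) | (x : ℕ) + 1 = w' i} := by
    rintro ω rfl i hi
    have hi : i < n := by simpa using hi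
    simp [w', hi]
  refine (measure_mono hset).trans ?_
  rw [Measure.infinitePi_pi _ fun i _ => MeasurableSet.of_discrete, ← Finset.prod_inv_distrib,
    ENNReal.ofReal_prod_of_nonneg fun i _ => by positivity]
  refine Finset.prod_le_prod' fun i _ => ?_
  have hv : 0 < v i := Nat.pos_of_neZero _
  have hcard : Measure.count {x : Fin (v i) | (x : ℕ) + 1 = w' i} ≤ 1 := by
    have hsub : {x : Fin (v i) | (x : ℕ) + 1 = w' i}.Subsingleton := fun a ha b hb => by
      ext
      exact Nat.succ_injective (ha.trans hb.symm)
    rcases hsub.eq_empty_or_singleton with h | ⟨a, h⟩ <;> simp [h]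
  rw [ProbabilityTheory.uniformOn_univ, Fintype.card_fin,
    ENNReal.ofReal_inv_of_pos (by exact_mod_cast hv), ENNReal.ofReal_natCast, div_eq_mul_inv]
  simpa using mul_le_mul_left hcard ((v i : ℝ≥0∞)⁻¹)

lemma finite_setOf_validWord (v : ℕ → ℕ) (n : ℕ) : {w : Fin n → ℕ | validWord v w}.Finite := by
  refine (Set.Finite.pi' fun i : Fin n => Set.finite_Icc 1 (v i)).subset fun w hw i => ?_
  exact hw i

lemma validWord_succ {v : ℕ → ℕ} (ω : (i : ℕ) → Fin (v i)) (n : ℕ) :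
    validWord v fun i : Fin n => (ω i : ℕ) + 1 :=
  fun i => ⟨Nat.le_add_left _ _, (ω i).2⟩

/-- A nested family of compact sets whose diameters tend to `0` has a continuous coding map. -/
lemma exists_continuous_coding {X : Type*} [MetricSpace X] {v : ℕ → ℕ}
    {K : (n : ℕ) → (Fin n → ℕ) → Set X} {D : ℕ → ℝ} (hD0 : Tendsto D atTop (nhds 0))
    (hdiam : ∀ n, 1 ≤ n → ∀ w : Fin n → ℕ, validWord v w → diam (K n w) ≤ D n)
    (hcpt : ∀ n, 1 ≤ n → ∀ w : Fin n → ℕ, validWord v w → IsCompact (K n w))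
    (hne : ∀ n, 1 ≤ n → ∀ w : Fin n → ℕ, validWord v w → (K n w).Nonempty)
    (hnest : ∀ n, 1 ≤ n → ∀ w : Fin (n + 1) → ℕ, validWord v w →
      K (n + 1) w ⊆ K n (fun i => w i.castSucc)) :
    ∃ pt : ((i : ℕ) → Fin (v i)) → X, Continuous pt ∧
      ∀ ω n, 1 ≤ n → pt ω ∈ K n fun i => (ω i : ℕ) + 1 := by
  have hex : ∀ ω : (i : ℕ) → Fin (v i), ∃ x, ∀ n, 1 ≤ n → x ∈ K n fun i => (ω i : ℕ) + 1 := by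
    intro ω
    obtain ⟨x, hx⟩ := IsCompact.nonempty_iInter_of_sequence_nonempty_isCompact_isClosed
      (fun n => K (n + 1) fun i => (ω i : ℕ) + 1)
      (fun n => hnest (n + 1) (by omega) _ (validWord_succ ω _))
      (fun n => hne _ (by omega) _ (validWord_succ ω _))
      (hcpt _ (by omega) _ (validWord_succ ω _))
      (fun n => (hcpt _ (by omega) _ (validWord_succ ω _)).isClosed)
    refine ⟨x, fun n hn => ?_⟩
    obtain ⟨m, rfl⟩ := Nat.exists_eq_add_of_le' hn
    exact mem_iInter.1 hx m
  choose pt hpt using hex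
  refine ⟨pt, continuous_iff_continuousAt.2 fun ω => Metric.tendsto_nhds.2 fun ε hε => ?_, hpt⟩
  obtain ⟨n, hnε, hn⟩ :=
    ((hD0.eventually (gt_mem_nhds hε)).and (eventually_ge_atTop 1)).exists
  have hev : ∀ᶠ ω' in nhds ω, ∀ i : Fin n, ω' i = ω i := by
    refine eventually_all.2 fun i => ?_
    exact (continuous_apply (i : ℕ)).continuousAt.eventually
      ((isOpen_discrete {ω i}).mem_nhds rfl)
  filter_upwards [hev] with ω' hω'
  have hmem : pt ω' ∈ K n fun i => (ω i : ℕ) + 1 := by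
    have := hpt ω' n hn
    simpa only [hω'] using this
  exact ((dist_le_diam_of_mem (hcpt n hn _ (validWord_succ ω n)).isBounded hmem
    (hpt ω n hn)).trans (hdiam n hn _ (validWord_succ ω n))).trans_lt hnε

/-- Generalization of Hata's dimension estimate: for a nested family of convex sets
`K(w)`, `w ∈ Σ_n`, with disjoint interiors, diameters tending to `0`, comparable diameters
(`d_n/D_n > b`) and projections of size at least `b·d_n`, the limit set
`E = ⋂_n ⋃_{w ∈ Σ_n} K(w)` satisfies
`dim E ≥ liminf log(v_1 ⋯ v_{n-1})/(−log d_n)`. -/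
theorem statement11 (d : ℕ) (v : ℕ → ℕ) (hv : ∀ n, 0 < v n) (b : ℝ)
    (hb : b ∈ Set.Ioo (0 : ℝ) 1)
    (K : (n : ℕ) → (Fin n → ℕ) → Set (EuclideanSpace ℝ (Fin d)))
    (Dn dn : ℕ → ℝ)
    (hDn : ∀ n, Dn n = sSup {x : ℝ | ∃ w : Fin n → ℕ, validWord v w ∧ x = diam (K n w)})
    (hdn : ∀ n, dn n = sInf {x : ℝ | ∃ w : Fin n → ℕ, validWord v w ∧ x = diam (K n w)})
    (hconv : ∀ n, 1 ≤ n → ∀ w : Fin n → ℕ, validWord v w →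
      IsCompact (K n w) ∧ Convex ℝ (K n w))
    (hnest : ∀ n, 1 ≤ n → ∀ w : Fin (n + 1) → ℕ, validWord v w →
      K (n + 1) w ⊆ K n (fun i => w i.castSucc))
    (hdisj : ∀ n, 1 ≤ n → ∀ w w' : Fin n → ℕ, validWord v w → validWord v w' → w ≠ w' →
      interior (K n w) ∩ interior (K n w') = ∅)
    (hD0 : Tendsto Dn atTop (nhds 0))
    (hcomp : ∀ n, 1 ≤ n → b * Dn n < dn n)
    (hproj : ∀ n, 1 ≤ n → ∀ w : Fin n → ℕ, validWord v w →
      ∀ θ : EuclideanSpace ℝ (Fin d), ‖θ‖ = 1 →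
        b * dn n ≤ (volume ((fun z => ⟪θ, z⟫) '' K n w)).toReal) :
    ENNReal.ofReal
        (liminf (fun n => Real.log (∏ i ∈ Finset.range (n - 1), (v i : ℝ)) /
          (-Real.log (dn n))) atTop) ≤
      dimH (⋂ (n : ℕ) (_ : 1 ≤ n), ⋃ (w : Fin n → ℕ) (_ : validWord v w), K n w) := by
  obtain ⟨hb0, hb1⟩ := hb
  have hfin : ∀ n, {x : ℝ | ∃ w : Fin n → ℕ, validWord v w ∧ x = diam (K n w)}.Finite := fun n =>
    ((finite_setOf_validWord v n).image fun w => diam (K n w)).subset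
      (by rintro _ ⟨w, hw, rfl⟩; exact ⟨w, hw, rfl⟩)
  have hle : ∀ n (w : Fin n → ℕ), validWord v w → diam (K n w) ≤ Dn n := fun n w hw => by
    rw [hDn]; exact le_csSup (hfin n).bddAbove ⟨w, hw, rfl⟩
  have hge : ∀ n (w : Fin n → ℕ), validWord v w → dn n ≤ diam (K n w) := fun n w hw => by
    rw [hdn]; exact csInf_le (hfin n).bddBelow ⟨w, hw, rfl⟩
  have hone : ∀ n, validWord v fun _ : Fin n => 1 := fun n i => ⟨le_rfl, hv i⟩
  have hdD : ∀ n, dn n ≤ Dn n := fun n => (hge n _ (hone n)).trans (hle n _ (hone n))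
  have hDpos : ∀ n, 1 ≤ n → 0 < Dn n := fun n hn => by nlinarith [hcomp n hn, hdD n]
  have hpos : ∀ n, 1 ≤ n → 0 < dn n := fun n hn =>
    (mul_pos hb0 (hDpos n hn)).trans (hcomp n hn)
  have hne : ∀ n, 1 ≤ n → ∀ w : Fin n → ℕ, validWord v w → (K n w).Nonempty := by
    intro n hn w hw
    rw [nonempty_iff_ne_empty]
    intro h
    have := hge n w hw
    rw [h, diam_empty] at this
    linarith [hpos n hn]
  have hd : 0 < d := by
    rcases Nat.eq_zero_or_pos d with rfl | h
    · have := hge 1 _ (hone 1)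
      rw [diam_subsingleton Set.subsingleton_of_subsingleton] at this
      linarith [hpos 1 le_rfl]
    · exact h
  have hdn0 : Tendsto dn atTop (nhds 0) :=
    tendsto_of_tendsto_of_tendsto_of_le_of_le' tendsto_const_nhds hD0
      (by filter_upwards [eventually_ge_atTop 1] with n hn using (hpos n hn).le)
      (Eventually.of_forall hdD)
  obtain ⟨pt, hptc, hpt⟩ := exists_continuous_coding hD0 (fun n _ => hle n)
    (fun n hn w hw => (hconv n hn w hw).1) hne hnest
  have : ∀ i, NeZero (v i) := fun i => ⟨(hv i).ne'⟩
  let P : Measure ((i : ℕ) → Fin (v i)) :=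
    Measure.infinitePi fun i => ProbabilityTheory.uniformOn (univ : Set (Fin (v i)))
  have hptm : Measurable pt := hptc.measurable
  set E := ⋂ (n : ℕ) (_ : 1 ≤ n), ⋃ (w : Fin n → ℕ) (_ : validWord v w), K n w with hEdef
  have hE : P.map pt E ≠ 0 := by
    have h1 : pt ⁻¹' E = univ := by
      refine eq_univ_of_forall fun ω => ?_
      simp only [hEdef, mem_preimage, mem_iInter, mem_iUnion]
      exact fun n hn => ⟨_, validWord_succ ω n, hpt ω n hn⟩
    have h2 := Measure.le_map_apply hptm.aemeasurable (μ := P) E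
    rw [h1, measure_univ] at h2
    exact (zero_lt_one.trans_le h2).ne'
  set V : ℕ → ℝ := fun n => ∏ i ∈ Finset.range n, (v i : ℝ) with hVdef
  have hVpos : ∀ n, 0 < V n := fun n => Finset.prod_pos fun i _ => by exact_mod_cast hv i
  have hd' : (0 : ℝ) < d := by exact_mod_cast hd
  set c : ℝ := (volume (ball (0 : EuclideanSpace ℝ (Fin d)) 1)).toReal with hc
  have hcpos : 0 < c :=
    ENNReal.toReal_pos (measure_ball_pos _ _ one_pos).ne' measure_ball_lt_top.ne
  set C : ℝ := (2 / b) ^ d * c / (b / (4 * d)) ^ d with hC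
  have hCpos : 0 < C := by positivity
  have hμ : ∀ n, 1 ≤ n → ∀ S : Set (EuclideanSpace ℝ (Fin d)), ediam S ≤ ENNReal.ofReal (dn n) →
      P.map pt S ≤ ENNReal.ofReal (C * (V n)⁻¹) := by
    intro n hn S hS
    rcases S.eq_empty_or_nonempty with rfl | ⟨x, hx⟩
    · simp
    refine (measure_mono subset_closure).trans ?_
    rw [Measure.map_apply hptm isClosed_closure.measurableSet]
    classical
    let T : Finset (Fin n → ℕ) :=
      {w ∈ (finite_setOf_validWord v n).toFinset | (K n w ∩ closure S).Nonempty}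
    have hT : ∀ w ∈ T, validWord v w ∧ (K n w ∩ closure S).Nonempty := fun w hw => by
      simpa [T] using hw
    have hbd : ∀ w ∈ T, K n w ⊆ closedBall x (2 * dn n / b) := by
      intro w hw y hy
      obtain ⟨hwv, z, hzK, hzS⟩ := hT w hw
      have h1 : dist y z ≤ Dn n :=
        (dist_le_diam_of_mem (hconv n hn w hwv).1.isBounded hy hzK).trans (hle n w hwv)
      have h2 : dist z x ≤ dn n := by
        have h3 := (edist_le_ediam_of_mem hzS (subset_closure hx)).trans
          ((ediam_closure S).le.trans hS)
        rw [edist_dist] at h3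
        exact (ENNReal.ofReal_le_ofReal_iff (hpos n hn).le).1 h3
      rw [mem_closedBall, le_div_iff₀ hb0]
      have h4 := dist_triangle y z x
      nlinarith [hcomp n hn, hpos n hn]
    have hcard : (T.card : ℝ) ≤ C := by
      have h5 := card_mul_le_of_interior_disjoint hd (T := T) (A := K n)
        (mul_pos hb0 (hpos n hn)) (div_nonneg (by linarith [hpos n hn]) hb0.le)
        (fun w hw => hne n hn w (hT w hw).1) (fun w hw => (hconv n hn w (hT w hw).1).2)
        (fun w hw => hproj n hn w (hT w hw).1)
        (fun w hw w' hw' => hdisj n hn w w' (hT w hw).1 (hT w' hw').1) hbd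
      rw [hC, le_div_iff₀ (by positivity)]
      have h6 : 0 < dn n ^ d := pow_pos (hpos n hn) d
      refine le_of_mul_le_mul_right ?_ h6
      calc _ = (T.card : ℝ) * (b * dn n / (4 * d)) ^ d := by
            rw [mul_assoc, ← mul_pow]; congr 2; ring
        _ ≤ _ := h5
        _ = _ := by
            rw [mul_right_comm, ← mul_pow]; congr 2; ring
    calc P (pt ⁻¹' closure S)
        ≤ P (⋃ w ∈ T, {ω | (fun i : Fin n => (ω i : ℕ) + 1) = w}) := by
          refine measure_mono fun ω hω => ?_
          simp only [mem_iUnion]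
          refine ⟨_, ?_, rfl⟩
          simp only [T, Finset.mem_filter, Set.Finite.mem_toFinset]
          exact ⟨validWord_succ ω n, _, hpt ω n hn, hω⟩
      _ ≤ ∑ w ∈ T, P {ω | (fun i : Fin n => (ω i : ℕ) + 1) = w} := measure_biUnion_finset_le _ _
      _ ≤ ∑ _w ∈ T, ENNReal.ofReal (V n)⁻¹ :=
          Finset.sum_le_sum fun w _ => infinitePi_uniformOn_cylinder_le w
      _ = ENNReal.ofReal (T.card * (V n)⁻¹) := by
          rw [Finset.sum_const, nsmul_eq_mul, ENNReal.ofReal_mul (by positivity),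
            ENNReal.ofReal_natCast]
      _ ≤ ENNReal.ofReal (C * (V n)⁻¹) :=
          ENNReal.ofReal_le_ofReal (by
            have := hVpos n
            gcongr)
  refine ENNReal.le_of_forall_nnreal_lt fun s hs => ?_
  rcases eq_or_ne s 0 with rfl | hs0
  · simp
  rw [ENNReal.lt_ofReal_iff_toReal_lt ENNReal.coe_ne_top, ENNReal.coe_toReal, liminf_eq] at hs
  obtain ⟨a, ha, hsa⟩ := exists_lt_of_lt_csSup (by
    by_contra hemp
    rw [not_nonempty_iff_eq_empty.1 hemp, Real.sSup_empty] at hs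
    exact absurd hs (not_lt.2 s.2)) hs
  obtain ⟨n₀, hn₀⟩ := eventually_atTop.1
    ((show ∀ᶠ n in atTop, a ≤ _ from ha).and (hdn0.eventually (gt_mem_nhds one_pos)))
  refine le_dimH_of_measure_le hE (δ := dn) (V := V) hCpos (n₀ := n₀ + 1)
    (pos_iff_ne_zero.2 hs0) (fun n hn => hpos n (by omega)) hdn0 (fun n hn => hμ n (by omega))
    fun n hn => ?_
  obtain ⟨h1, h2⟩ := hn₀ (n + 1) (by omega)
  have h3 := hpos (n + 1) (by omega)
  have hlog : 0 < -Real.log (dn (n + 1)) := by linarith [Real.log_neg h3 h2]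
  rw [le_div_iff₀ hlog, Nat.add_sub_cancel] at h1
  have h4 : (s : ℝ) * -Real.log (dn (n + 1)) ≤ Real.log (V n) :=
    (mul_le_mul_of_nonneg_right hsa.le hlog.le).trans h1
  rw [← Real.log_le_log_iff (inv_pos.2 (hVpos n)) (Real.rpow_pos_of_pos h3 _), Real.log_inv,
    Real.log_rpow h3]
  linarith
end
end

section
/- Let {E_n}_{n≥1} be a nested decreasing sequence of compact subsets of ℝ² such that for each n, E_n = ⊔_{j=1}^{M_n} K_j^n is a finite disjoint union of closed convex sets. Suppose there exist λ > 0, c > 0, and σ ∈ (0,1) such that for every n: (i) |P_y(K_j^n)| ≤ λ·|P_x(K_j^n)| for all j (where P_x, P_y are projections onto the coordinate axes and |·| is Lebesgue measure); (ii) for all j ≠ k and all points z_j ∈ K_j^n, z_k ∈ K_k^n, one has P_x(z_j − z_k) ≠ 0 and |P_y(z_j − z_k)| ≤ λ·|P_x(z_j − z_k)|; (iii) diam(K_j^n) ≤ c·σ^n for all j. Then there exists a nondegenerate closed interval I ⊆ ℝ and a Lipschitz function g : I → ℝ with Lipschitz constant at most λ whose graph Γ = {(x, g(x)) : x ∈ I}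 contains ⋂_{n≥1} E_n. -/
open Set MeasureTheory Metric Real
open scoped ENNReal NNReal

noncomputable section

/-- A bounded planar set whose differences are `lam`-flat lies on the graph of a `lam`-Lipschitz
function over a nondegenerate closed interval. -/
theorem exists_lipschitzOnWith_graph_of_flat {S : Set E2} (hS : Bornology.IsBounded S) {lam : ℝ}
    (hflat : ∀ z ∈ S, ∀ w ∈ S, |z 1 - w 1| ≤ lam * |z 0 - w 0|) :
    ∃ a b : ℝ, a < b ∧ ∃ g : ℝ → ℝ,
      LipschitzOnWith (Real.toNNReal lam) g (Set.Icc a b) ∧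
      S ⊆ (fun x => pt x (g x)) '' Set.Icc a b := by
  obtain ⟨R, hRpos, hR⟩ := hS.exists_pos_norm_le
  set u : ℝ → E2 := Function.invFunOn (fun z : E2 => z 0) S
  have hu : ∀ z ∈ S, u (z 0) ∈ S ∧ u (z 0) 0 = z 0 := fun z hz =>
    Function.invFunOn_pos (f := fun z : E2 => z 0) ⟨z, hz, rfl⟩
  have hlip : LipschitzOnWith (Real.toNNReal lam) (fun x => u x 1)
      ((fun z : E2 => z 0) '' S) := by
    refine LipschitzOnWith.of_dist_le_mul ?_
    rintro _ ⟨z, hz, rfl⟩ _ ⟨w, hw, rfl⟩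
    have h := hflat _ (hu z hz).1 _ (hu w hw).1
    rw [(hu z hz).2, (hu w hw).2] at h
    rw [Real.dist_eq, Real.dist_eq]
    exact h.trans (mul_le_mul_of_nonneg_right (Real.le_coe_toNNReal lam) (abs_nonneg _))
  obtain ⟨g, hg, hgu⟩ := hlip.extend_real
  refine ⟨-R, R, by linarith, g, hg.lipschitzOnWith, fun z hz => ⟨z 0, ?_, ?_⟩⟩
  · exact abs_le.mp ((PiLp.norm_apply_le z 0).trans (hR z hz))
  · have h := hflat _ (hu z hz).1 _ hz
    rw [(hu z hz).2, sub_self, abs_zero, mul_zero, abs_nonpos_iff, sub_eq_zero] at h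
    have hgz : g (z 0) = z 1 := (hgu ⟨z, hz, rfl⟩).symm.trans h
    ext i
    fin_cases i <;> simp [pt, hgz]

/-- Graph construction: for a nested sequence of compact sets `E_n`, each a finite disjoint
union of closed convex pieces whose projections are `λ`-flat (i), whose mutual differences
are `λ`-flat with nonvanishing horizontal component (ii), and whose diameters decay like
`c σⁿ` (iii), there is a nondegenerate closed interval `I` and a `λ`-Lipschitz function
`g : I → ℝ` whose graph contains `⋂_n E_n`. -/
theorem statement12 (E : ℕ → Set E2) (Mn : ℕ → ℕ) (K : (n : ℕ) → Fin (Mn n) → Set E2)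
    (lam c σ : ℝ) (hlam : 0 < lam) (hc : 0 < c) (hσ : σ ∈ Set.Ioo (0 : ℝ) 1)
    (hcompact : ∀ n, 1 ≤ n → IsCompact (E n))
    (hnested : ∀ n, 1 ≤ n → E (n + 1) ⊆ E n)
    (hdecomp : ∀ n, 1 ≤ n → E n = ⋃ j, K n j)
    (hdisj : ∀ n, 1 ≤ n → ∀ j k : Fin (Mn n), j ≠ k → Disjoint (K n j) (K n k))
    (hclosed : ∀ n, 1 ≤ n → ∀ j, IsClosed (K n j) ∧ Convex ℝ (K n j))
    (hi : ∀ n, 1 ≤ n → ∀ j,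
      (volume ((fun p : E2 => p 1) '' K n j)).toReal ≤
        lam * (volume ((fun p : E2 => p 0) '' K n j)).toReal)
    (hii : ∀ n, 1 ≤ n → ∀ j k : Fin (Mn n), j ≠ k → ∀ zj ∈ K n j, ∀ zk ∈ K n k,
      zj 0 - zk 0 ≠ 0 ∧ |zj 1 - zk 1| ≤ lam * |zj 0 - zk 0|)
    (hiii : ∀ n, 1 ≤ n → ∀ j, diam (K n j) ≤ c * σ ^ n) :
    ∃ a b : ℝ, a < b ∧ ∃ g : ℝ → ℝ,
      LipschitzOnWith (Real.toNNReal lam) g (Set.Icc a b) ∧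
      (⋂ (n : ℕ) (_ : 1 ≤ n), E n) ⊆ (fun x => pt x (g x)) '' Set.Icc a b := by
  refine exists_lipschitzOnWith_graph_of_flat
    ((hcompact 1 le_rfl).isBounded.subset (iInter₂_subset 1 le_rfl)) fun z hz w hw => ?_
  rcases eq_or_ne z w with rfl | hzw
  · simp
  have hlim : Filter.Tendsto (fun n : ℕ => c * σ ^ n) Filter.atTop (nhds 0) := by
    simpa using (tendsto_pow_atTop_nhds_zero_of_lt_one hσ.1.le hσ.2).const_mul c
  obtain ⟨n, hn, hn1⟩ := ((hlim.eventually_lt_const (dist_pos.mpr hzw)).and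
    (Filter.eventually_ge_atTop 1)).exists
  have hz' := mem_iInter₂.mp hz n hn1
  have hw' := mem_iInter₂.mp hw n hn1
  rw [hdecomp n hn1] at hz' hw'
  obtain ⟨j, hj⟩ := mem_iUnion.mp hz'
  obtain ⟨k, hk⟩ := mem_iUnion.mp hw'
  have hjk : j ≠ k := by
    rintro rfl
    have hb : Bornology.IsBounded (K n j) := (hcompact n hn1).isBounded.subset
      (hdecomp n hn1 ▸ subset_iUnion (K n) j)
    linarith [dist_le_diam_of_mem hb hj hk, hiii n hn1 j]
  exact (hii n hn1 j k hjk z hj w hk).2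
end
end

section
/- Let {f_j}_{j=1}^N, f_j(x) = r_j x + z_j with 0 < r_1 ≤ ⋯ ≤ r_N < 1, be a rotation-free iterated function system on ℝ² with attractor C, and let {C_n}_{n≥0} be its generations with respect to K = conv(C). For any n ∈ ℕ, setting δ_n := (inf_{θ∈S¹} |P_θ(K)|)·(r_N/(4N))^n, one has Fav(C(δ_n)) ≤ 10·Fav(C_n), where C(δ_n) is the closed δ_n-neighborhood of C. -/
open Set MeasureTheory Metric Real
open scoped ENNReal NNReal

noncomputable section

/-- Orthogonal projection onto the line of angle `θ`: `P_θ(x,y) = x cos θ + y sin θ`. -/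
def projA (θ : ℝ) (z : E2) : ℝ := z 0 * Real.cos θ + z 1 * Real.sin θ

/-- The Favard length of a set `E ⊆ ℝ²`: the average over directions of the Lebesgue
measure of the projections `P_θ(E)`. -/
def fav (E : Set E2) : ℝ :=
  (1 / Real.pi) * ∫ θ in (0 : ℝ)..Real.pi, (volume (projA θ '' E)).toReal

/-- The composition `f_{w 0} ∘ f_{w 1} ∘ ⋯ ∘ f_{w (m-1)}` along a word `w` of length `m`. -/
def wmap {α : Type*} {N : ℕ} (f : Fin N → α → α) : (m : ℕ) → (Fin m → Fin N) → α → α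
  | 0, _ => id
  | m + 1, w => f (w 0) ∘ wmap f m (fun i => w i.succ)

theorem continuous_projA (θ : ℝ) : Continuous (projA θ) := by
  unfold projA
  fun_prop

theorem continuous_projA_uncurry : Continuous fun p : ℝ × E2 => projA p.1 p.2 := by
  unfold projA
  fun_prop

theorem projA_smul_add (θ c : ℝ) (x y : E2) :
    projA θ (c • x + y) = c * projA θ x + projA θ y := by
  simp only [projA, PiLp.add_apply, PiLp.smul_apply, smul_eq_mul]
  ring

/-- The projection `projA θ` is `1`-Lipschitz. -/
theorem abs_projA_sub_le (θ : ℝ) (x y : E2) : |projA θ x - projA θ y| ≤ dist x y := by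
  rw [EuclideanSpace.dist_eq, Fin.sum_univ_two, Real.dist_eq, Real.dist_eq, sq_abs, sq_abs]
  apply Real.le_sqrt_of_sq_le
  rw [sq_abs]
  unfold projA
  have h := Real.sin_sq_add_cos_sq θ
  have h2 : ((x 0 - y 0) ^ 2 + (x 1 - y 1) ^ 2) * (Real.sin θ ^ 2 + Real.cos θ ^ 2) =
      (x 0 - y 0) ^ 2 + (x 1 - y 1) ^ 2 := by rw [h, mul_one]
  nlinarith [sq_nonneg ((x 0 - y 0) * Real.sin θ - (x 1 - y 1) * Real.cos θ)]

/-- Enlarging finitely many intervals by `δ` at both ends adds at most `2δ` per interval to the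
measure of their union. -/
theorem volume_iUnion_Icc_enlarge_le {ι : Type*} [Fintype ι] (a b : ι → ℝ) {δ : ℝ} (hδ : 0 ≤ δ) :
    volume (⋃ i, Icc (a i - δ) (b i + δ)) ≤
      volume (⋃ i, Icc (a i) (b i)) + ENNReal.ofReal (Fintype.card ι * (2 * δ)) := by
  have hsub : (⋃ i, Icc (a i - δ) (b i + δ)) ⊆
      (⋃ i, Icc (a i) (b i)) ∪ ⋃ i, (Icc (a i - δ) (a i) ∪ Icc (b i) (b i + δ)) := by
    intro t ht
    obtain ⟨i, h1, h2⟩ := mem_iUnion.1 ht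
    rcases lt_or_ge t (a i) with h | h
    · exact Or.inr (mem_iUnion.2 ⟨i, Or.inl ⟨h1, h.le⟩⟩)
    rcases lt_or_ge (b i) t with h' | h'
    · exact Or.inr (mem_iUnion.2 ⟨i, Or.inr ⟨h'.le, h2⟩⟩)
    · exact Or.inl (mem_iUnion.2 ⟨i, h, h'⟩)
  refine (measure_mono hsub).trans ((measure_union_le _ _).trans ?_)
  gcongr
  refine (measure_iUnion_fintype_le _ _).trans ?_
  have hi : ∀ i, volume (Icc (a i - δ) (a i) ∪ Icc (b i) (b i + δ)) ≤ ENNReal.ofReal (2 * δ) := by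
    intro i
    refine (measure_union_le _ _).trans ?_
    rw [Real.volume_Icc, Real.volume_Icc, ← ENNReal.ofReal_add (by linarith) (by linarith)]
    apply ENNReal.ofReal_le_ofReal
    linarith
  refine (Finset.sum_le_sum fun i _ => hi i).trans ?_
  rw [Finset.sum_const, Finset.card_univ, nsmul_eq_mul, ENNReal.ofReal_mul (Nat.cast_nonneg _),
    ENNReal.ofReal_natCast]

/-- The convex hull of a compact set in a finite-dimensional space is compact. -/
theorem isCompact_convexHull {E : Type*} [NormedAddCommGroup E] [NormedSpace ℝ E]
    [FiniteDimensional ℝ E] {s : Set E} (hs : IsCompact s) : IsCompact (convexHull ℝ s) := by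
  set A : ℕ → Set E := fun k =>
    (fun p : (Fin k → ℝ) × (Fin k → E) => ∑ i, p.1 i • p.2 i) ''
      (stdSimplex ℝ (Fin k) ×ˢ Set.pi univ fun _ => s) with hA
  have hAc : ∀ k, IsCompact (A k) := fun k =>
    ((isCompact_stdSimplex ℝ (Fin k)).prod (isCompact_univ_pi fun _ => hs)).image (by fun_prop)
  have hEq : convexHull ℝ s = ⋃ k ∈ Finset.range (Module.finrank ℝ E + 2), A k := by
    apply Subset.antisymm
    · intro x hx
      obtain ⟨ι, _, p, w, hp, hind, hw, hw1, hwx⟩ := eq_pos_convex_span_of_mem_convexHull hx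
      let e := (Fintype.equivFin ι).symm
      have hcard : Fintype.card ι ≤ Module.finrank ℝ E + 1 :=
        hind.card_le_finrank_succ.trans (Nat.succ_le_succ (Submodule.finrank_le _))
      refine mem_iUnion₂.2 ⟨Fintype.card ι, Finset.mem_range.2 (by omega), (w ∘ e, p ∘ e),
        ⟨⟨fun i => (hw _).le, ?_⟩, fun i _ => hp (mem_range_self _)⟩, ?_⟩
      · exact (e.sum_comp w).trans hw1
      · exact (e.sum_comp fun i => w i • p i).trans hwx
    · refine iUnion₂_subset fun k _ => ?_
      rintro _ ⟨⟨w, p⟩, ⟨⟨hw, hw1⟩, hp⟩, rfl⟩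
      exact (convex_convexHull ℝ s).sum_mem (fun i _ => hw i) hw1
        fun i _ => subset_convexHull ℝ s (hp i (mem_univ i))
  rw [hEq]
  exact (Finset.range _).isCompact_biUnion fun k _ => hAc k

/-- The measure of the projections of a compact set is an integrable function of the angle. -/
theorem integrableOn_volume_projA {E : Set E2} (hE : IsCompact E) :
    IntegrableOn (fun θ => (volume (projA θ '' E)).toReal) (Ioc 0 Real.pi) := by
  set S : Set (ℝ × ℝ) := (fun p : ℝ × E2 => (p.1, projA p.1 p.2)) '' (Icc 0 Real.pi ×ˢ E) with hS
  have hSc : IsCompact S :=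
    (isCompact_Icc.prod hE).image (continuous_fst.prodMk continuous_projA_uncurry)
  have hfib : ∀ θ ∈ Ioc 0 Real.pi, projA θ '' E = Prod.mk θ ⁻¹' S := by
    intro θ hθ
    ext t
    constructor
    · rintro ⟨x, hx, rfl⟩
      exact ⟨(θ, x), ⟨Ioc_subset_Icc_self hθ, hx⟩, rfl⟩
    · rintro ⟨⟨φ, x⟩, ⟨-, hx⟩, h⟩
      simp only [Prod.mk.injEq] at h
      obtain ⟨rfl, rfl⟩ := h
      exact ⟨x, hx, rfl⟩
  have hfin : volume (Prod.snd '' S) < ⊤ := (hSc.image continuous_snd).measure_lt_top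
  have hle : ∀ θ, volume (Prod.mk θ ⁻¹' S) ≤ volume (Prod.snd '' S) := fun θ =>
    measure_mono fun t ht => ⟨(θ, t), ht, rfl⟩
  have hint : IntegrableOn (fun θ => (volume (Prod.mk θ ⁻¹' S)).toReal) (Ioc 0 Real.pi) := by
    refine Measure.integrableOn_of_bounded (M := (volume (Prod.snd '' S)).toReal) (by simp)
      (measurable_measure_prodMk_left hSc.measurableSet).ennreal_toReal.aestronglyMeasurable
      (Filter.Eventually.of_forall fun θ => ?_)
    rw [Real.norm_of_nonneg ENNReal.toReal_nonneg]
    exact ENNReal.toReal_mono hfin.ne (hle θ)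
  exact hint.congr_fun (fun θ hθ => by simp only [hfib θ hθ]) measurableSet_Ioc

/-- A pointwise comparison of projections integrates to a comparison of Favard lengths. -/
theorem fav_le_mul_fav {E F : Set E2} (hF : IsCompact F) (c : ℝ)
    (h : ∀ θ, (volume (projA θ '' E)).toReal ≤ c * (volume (projA θ '' F)).toReal) :
    fav E ≤ c * fav F := by
  unfold fav
  rw [mul_left_comm]
  gcongr
  rw [intervalIntegral.integral_of_le Real.pi_pos.le,
    intervalIntegral.integral_of_le Real.pi_pos.le, ← integral_const_mul]
  exact integral_mono_of_nonneg (Filter.Eventually.of_forall fun _ => ENNReal.toReal_nonneg)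
    ((integrableOn_volume_projA hF).const_mul c) (Filter.Eventually.of_forall h)

theorem continuous_wmap {α : Type*} [TopologicalSpace α] {N : ℕ} {f : Fin N → α → α}
    (hf : ∀ j, Continuous (f j)) : ∀ (m : ℕ) (w : Fin m → Fin N), Continuous (wmap f m w)
  | 0, _ => continuous_id
  | m + 1, w => (hf (w 0)).comp (continuous_wmap hf m _)

theorem subset_iUnion_wmap_image {α : Type*} {N : ℕ} {f : Fin N → α → α} {C : Set α}
    (hC : C ⊆ ⋃ j, f j '' C) : ∀ m : ℕ, C ⊆ ⋃ w : Fin m → Fin N, wmap f m w '' C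
  | 0 => fun x hx => mem_iUnion.2 ⟨Fin.elim0, x, hx, rfl⟩
  | m + 1 => by
    intro x hx
    obtain ⟨j, y, hy, rfl⟩ := mem_iUnion.1 (hC hx)
    obtain ⟨w, u, hu, rfl⟩ := mem_iUnion.1 (subset_iUnion_wmap_image hC m hy)
    exact mem_iUnion.2 ⟨Fin.cons j w, u, hu, by simp [wmap]⟩

theorem exists_wmap_const {N : ℕ} {f : Fin N → E2 → E2} {c : ℝ} {v : E2} {j : Fin N}
    (hf : ∀ x, f j x = c • x + v) :
    ∀ m : ℕ, ∃ u : E2, ∀ x, wmap f m (fun _ => j) x = c ^ m • x + u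
  | 0 => ⟨0, fun x => by simp [wmap]⟩
  | m + 1 => by
    obtain ⟨u, hu⟩ := exists_wmap_const hf m
    refine ⟨c • u + v, fun x => ?_⟩
    simp only [wmap, Function.comp_apply, hu, hf, smul_add, smul_smul, pow_succ', add_assoc]

theorem volume_projA_image_smul_add (θ : ℝ) {c : ℝ} (hc : 0 ≤ c) (u : E2) (K : Set E2) :
    volume (projA θ '' ((fun x => c • x + u) '' K)) =
      ENNReal.ofReal c * volume (projA θ '' K) := by
  have h : projA θ '' ((fun x => c • x + u) '' K) =
      (fun t => t + projA θ u) '' ((fun t => c • t) '' (projA θ '' K)) := by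
    simp only [image_image, projA_smul_add, smul_eq_mul]
  rw [h, image_add_right, measure_preimage_add_right, image_smul, Measure.addHaar_smul]
  simp [abs_of_nonneg hc]

/-- Thickening a subset of a finite union of compact connected sets increases the measure of the
projection by at most `2δ` per piece. -/
theorem volume_projA_cthickening_le {ι : Type*} [Fintype ι] {C : Set E2} (hC : IsCompact C)
    {A : ι → Set E2} (hA : ∀ i, IsCompact (A i)) (hconn : ∀ i, IsConnected (A i))
    (hsub : C ⊆ ⋃ i, A i) {δ : ℝ} (hδ : 0 ≤ δ) (θ : ℝ) :
    volume (projA θ '' cthickening δ C) ≤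
      volume (projA θ '' ⋃ i, A i) + ENNReal.ofReal (Fintype.card ι * (2 * δ)) := by
  have hIcc : ∀ i, projA θ '' A i =
      Icc (sInf (projA θ '' A i)) (sSup (projA θ '' A i)) := fun i =>
    eq_Icc_of_connected_compact ((hconn i).image _ (continuous_projA θ).continuousOn)
      ((hA i).image (continuous_projA θ))
  have hU : projA θ '' (⋃ i, A i) =
      ⋃ i, Icc (sInf (projA θ '' A i)) (sSup (projA θ '' A i)) := by
    rw [image_iUnion]
    exact iUnion_congr hIcc
  rw [hU]
  refine le_trans (measure_mono ?_) (volume_iUnion_Icc_enlarge_le _ _ hδ)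
  rintro _ ⟨x, hx, rfl⟩
  rw [hC.cthickening_eq_biUnion_closedBall hδ] at hx
  obtain ⟨y, hy, hxy⟩ := mem_iUnion₂.1 hx
  obtain ⟨i, hi⟩ := mem_iUnion.1 (hsub hy)
  have hyi : projA θ y ∈ Icc (sInf (projA θ '' A i)) (sSup (projA θ '' A i)) :=
    hIcc i ▸ mem_image_of_mem _ hi
  have hd := abs_le.1 ((abs_projA_sub_le θ x y).trans (mem_closedBall.1 hxy))
  exact mem_iUnion.2 ⟨i, by linarith [hyi.1, hd.1], by linarith [hyi.2, hd.2]⟩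

/-- Favard length neighborhood comparison: for a rotation-free IFS with attractor `C` and
generations `C_n` with respect to `K = conv C`, setting
`δ_n = (inf_θ |P_θ(K)|)·(r_N/(4N))^n`, one has `Fav(C(δ_n)) ≤ 10·Fav(C_n)`. -/
theorem statement14 (N : ℕ) (hN : 0 < N) (r : Fin N → ℝ) (z : Fin N → E2)
    (f : Fin N → E2 → E2)
    (hr : ∀ j, r j ∈ Set.Ioo (0 : ℝ) 1) (hmono : Monotone r)
    (hf : ∀ j x, f j x = r j • x + z j)
    (C : Set E2) (hCc : IsCompact C) (hCne : C.Nonempty)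
    (hCinv : C = ⋃ j, f j '' C)
    (ν : ℝ) (hν : ν = ⨅ θ : ℝ, (volume (projA θ '' convexHull ℝ C)).toReal) :
    ∀ n : ℕ,
      fav (Metric.cthickening (ν * (r ⟨N - 1, Nat.sub_lt hN Nat.one_pos⟩ / (4 * N)) ^ n) C) ≤
        10 * fav (⋃ w : Fin n → Fin N, wmap f n w '' convexHull ℝ C) := by
  intro n
  set j : Fin N := ⟨N - 1, Nat.sub_lt hN Nat.one_pos⟩ with hj
  set K : Set E2 := convexHull ℝ C with hK
  have hKc : IsCompact K := isCompact_convexHull hCc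
  have hKconn : IsConnected K :=
    ⟨hCne.convexHull, (convex_convexHull ℝ C).isPreconnected⟩
  have hfc : ∀ j, Continuous (f j) := fun j => by
    rw [funext (hf j)]
    fun_prop
  have hAc : ∀ w : Fin n → Fin N, IsCompact (wmap f n w '' K) := fun w =>
    hKc.image (continuous_wmap hfc n w)
  have hAconn : ∀ w : Fin n → Fin N, IsConnected (wmap f n w '' K) := fun w =>
    hKconn.image _ (continuous_wmap hfc n w).continuousOn
  have hCn : C ⊆ ⋃ w : Fin n → Fin N, wmap f n w '' K :=
    (subset_iUnion_wmap_image hCinv.subset n).trans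
      (iUnion_mono fun w => image_mono (subset_convexHull ℝ C))
  have hν0 : 0 ≤ ν := hν ▸ Real.iInf_nonneg fun _ => ENNReal.toReal_nonneg
  have hr0 : 0 < r j := (hr j).1
  have hNR : (0 : ℝ) < N := Nat.cast_pos.2 hN
  set δ : ℝ := ν * (r j / (4 * N)) ^ n with hδ
  have hδ0 : 0 ≤ δ := by positivity
  have hcount : (Fintype.card (Fin n → Fin N) : ℝ) * (2 * δ) ≤ 2 * (r j ^ n * ν) := by
    have h4 : (1 : ℝ) ≤ 4 ^ n := one_le_pow₀ (by norm_num)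
    have : (Fintype.card (Fin n → Fin N) : ℝ) * (2 * δ) = 2 * (r j ^ n * ν) / 4 ^ n := by
      rw [hδ, div_pow, mul_pow]
      simp only [Fintype.card_pi, Fintype.card_fin, Finset.prod_const, Finset.card_univ,
        Nat.cast_pow]
      field_simp
    rw [this]
    exact div_le_self (by positivity) h4
  have hUc : IsCompact (⋃ w : Fin n → Fin N, wmap f n w '' K) := isCompact_iUnion hAc
  refine fav_le_mul_fav hUc 10 fun θ => ?_
  have hUfin : volume (projA θ '' ⋃ w : Fin n → Fin N, wmap f n w '' K) ≠ ⊤ :=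
    (hUc.image (continuous_projA θ)).measure_lt_top.ne
  have hνK : ν ≤ (volume (projA θ '' K)).toReal :=
    hν ▸ ciInf_le ⟨0, by rintro _ ⟨φ, rfl⟩; exact ENNReal.toReal_nonneg⟩ θ
  have hlow : r j ^ n * ν ≤
      (volume (projA θ '' ⋃ w : Fin n → Fin N, wmap f n w '' K)).toReal := by
    obtain ⟨u, hu⟩ := exists_wmap_const (f := f) (hf j) n
    have hv := volume_projA_image_smul_add θ (pow_nonneg hr0.le n) u K
    rw [← funext hu] at hv
    calc r j ^ n * ν ≤ r j ^ n * (volume (projA θ '' K)).toReal := by gcongr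
      _ = (volume (projA θ '' (wmap f n (fun _ => j) '' K))).toReal := by
        rw [hv, ENNReal.toReal_mul, ENNReal.toReal_ofReal (pow_nonneg hr0.le n)]
      _ ≤ _ := ENNReal.toReal_mono hUfin (measure_mono (image_mono
        (subset_iUnion (fun w : Fin n → Fin N => wmap f n w '' K) fun _ => j)))
  have hup := ENNReal.toReal_mono (ENNReal.add_ne_top.2 ⟨hUfin, ENNReal.ofReal_ne_top⟩)
    (volume_projA_cthickening_le hCc hAc hAconn hCn hδ0 θ)
  rw [ENNReal.toReal_add hUfin ENNReal.ofReal_ne_top,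
    ENNReal.toReal_ofReal (by positivity)] at hup
  linarith [mul_nonneg (pow_nonneg hr0.le n) hν0]
end
end

section
/- Let J ⊆ [0, π) be a Borel set with Lebesgue measure |J| ≥ π − ε for some ε > 0, and let φ ∈ [0, π). Define the rotation map T_φ : [0, π) → [0, π) by T_φ(θ) = θ + φ if θ ∈ [0, π − φ) and T_φ(θ) = θ + φ − π if θ ∈ [π − φ, π), and for θ ∈ [0, π) and n ∈ ℕ let D(n; θ) = (1/n)·#{k ∈ {0, 1, …, n−1} : T_φ^k(θ) ∈ J}. Then there exists θ ∈ [0, π) such that D(n; θ) ≥ 1 − ε/2 for every n ∈ ℕ. -/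
open Set MeasureTheory Real
open scoped ENNReal NNReal

noncomputable section

/-- The rotation map `T_φ : [0, π) → [0, π)`, `T_φ(θ) = θ + φ (mod π)`. -/
def rotMap (φ : ℝ) (θ : ℝ) : ℝ :=
  if θ < Real.pi - φ then θ + φ else θ + φ - Real.pi

/-- The running maximum `max (0, S₁, …, S_N)` of the Birkhoff sums of `f` along `T`, defined by
the recursion `M_{N+1} = max (0, f + M_N ∘ T)`. -/
def birkhoffMax {α : Type*} (T : α → α) (f : α → ℝ) : ℕ → α → ℝ
  | 0 => fun _ => 0
  | N + 1 => fun x => max 0 (f x + birkhoffMax T f N (T x))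

theorem birkhoffMax_le_succ {α : Type*} (T : α → α) (f : α → ℝ) (N : ℕ) (x : α) :
    birkhoffMax T f N x ≤ birkhoffMax T f (N + 1) x := by
  induction N generalizing x with
  | zero => exact le_max_left _ _
  | succ N ih => exact max_le_max le_rfl (by gcongr; exact ih (T x))

theorem birkhoffSum_le_birkhoffMax {α : Type*} (T : α → α) (f : α → ℝ) (n : ℕ) (x : α) :
    birkhoffSum T f n x ≤ birkhoffMax T f n x := by
  induction n generalizing x with
  | zero => simp [birkhoffMax]
  | succ n ih =>
    rw [birkhoffSum_succ']
    exact le_max_of_le_right (by gcongr; exact ih (T x))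

theorem integrable_birkhoffMax {α : Type*} [MeasurableSpace α] {μ : Measure α}
    {T : α → α} (hT : MeasurePreserving T μ μ) {f : α → ℝ} (hf : Integrable f μ) (N : ℕ) :
    Integrable (birkhoffMax T f N) μ := by
  induction N with
  | zero => exact integrable_zero _ _ _
  | succ N ih => exact (integrable_zero α ℝ μ).sup (hf.add (hT.integrable_comp_of_integrable ih))

theorem measurable_birkhoffMax {α : Type*} [MeasurableSpace α] {T : α → α} (hT : Measurable T)
    {f : α → ℝ} (hf : Measurable f) (N : ℕ) : Measurable (birkhoffMax T f N) := by
  induction N with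
  | zero => exact measurable_const
  | succ N ih => exact measurable_const.max (hf.add (ih.comp hT))

/-- **Maximal ergodic theorem**, on the set where some Birkhoff sum up to time `N + 1` is
positive. -/
theorem setIntegral_birkhoffMax_pos_nonneg {α : Type*} [MeasurableSpace α] {μ : Measure α}
    {T : α → α} (hT : MeasurePreserving T μ μ) {f : α → ℝ} (hfm : Measurable f)
    (hf : Integrable f μ) (N : ℕ) :
    0 ≤ ∫ x in {x | 0 < f x + birkhoffMax T f N (T x)}, f x ∂μ := by
  set A : Set α := {x | 0 < f x + birkhoffMax T f N (T x)}
  have hMm := measurable_birkhoffMax hT.measurable hfm N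
  have hA : MeasurableSet A :=
    measurableSet_lt measurable_const (hfm.add (hMm.comp hT.measurable))
  have hM := integrable_birkhoffMax hT hf N
  have hMT : Integrable (fun x => birkhoffMax T f N (T x)) μ := hT.integrable_comp_of_integrable hM
  have hnonneg : ∀ x, 0 ≤ birkhoffMax T f N x := by
    cases N with
    | zero => exact fun _ => le_rfl
    | succ N => exact fun _ => le_max_left _ _
  have hsucc : birkhoffMax T f (N + 1)
      = A.indicator (fun x => f x + birkhoffMax T f N (T x)) := by
    ext x
    by_cases hx : x ∈ A
    · rw [indicator_of_mem hx]
      exact max_eq_right (le_of_lt hx)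
    · rw [indicator_of_notMem hx]
      exact max_eq_left (not_lt.mp hx)
  have hle : ∫ x, birkhoffMax T f N x ∂μ ≤ ∫ x, birkhoffMax T f (N + 1) x ∂μ :=
    integral_mono hM (integrable_birkhoffMax hT hf (N + 1)) (birkhoffMax_le_succ T f N)
  rw [hsucc, integral_indicator hA, integral_add hf.integrableOn hMT.integrableOn] at hle
  have hrestrict : ∫ x in A, birkhoffMax T f N (T x) ∂μ ≤ ∫ x, birkhoffMax T f N (T x) ∂μ :=
    setIntegral_le_integral hMT (.of_forall fun x => hnonneg (T x))
  have hinv : ∫ x, birkhoffMax T f N (T x) ∂μ = ∫ x, birkhoffMax T f N x ∂μ := by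
    rw [← integral_map hT.aemeasurable hMm.aestronglyMeasurable, hT.map_eq]
  linarith

/-- If almost every point has a positive Birkhoff sum, then the integral is nonnegative. -/
theorem integral_nonneg_of_ae_exists_birkhoffSum_pos {α : Type*} [MeasurableSpace α]
    {μ : Measure α} {T : α → α} (hT : MeasurePreserving T μ μ) {f : α → ℝ} (hfm : Measurable f)
    (hf : Integrable f μ) (hpos : ∀ᵐ x ∂μ, ∃ n, 0 < birkhoffSum T f n x) :
    0 ≤ ∫ x, f x ∂μ := by
  set A : ℕ → Set α := fun N => {x | 0 < f x + birkhoffMax T f N (T x)}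
  have hA : ∀ N, MeasurableSet (A N) := fun N => measurableSet_lt measurable_const
    (hfm.add ((measurable_birkhoffMax hT.measurable hfm N).comp hT.measurable))
  have hmono : Monotone A := monotone_nat_of_le_succ fun N => by
    intro x hx
    exact lt_of_lt_of_le hx (add_le_add_right (birkhoffMax_le_succ T f N (T x)) (f x))
  have hlim := tendsto_setIntegral_of_monotone hA hmono (f := f) (μ := μ) hf.integrableOn
  have huniv : (⋃ N, A N) =ᵐ[μ] univ := by
    rw [Filter.eventuallyEq_univ]
    filter_upwards [hpos] with x ⟨n, hn⟩
    cases n with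
    | zero => simp at hn
    | succ n =>
      rw [birkhoffSum_succ'] at hn
      exact mem_iUnion.mpr
        ⟨n, hn.trans_le (by gcongr; exact birkhoffSum_le_birkhoffMax T f n (T x))⟩
  rw [setIntegral_congr_set huniv, setIntegral_univ] at hlim
  exact ge_of_tendsto' hlim fun N => setIntegral_birkhoffMax_pos_nonneg hT hfm hf N

theorem measurable_rotMap (φ : ℝ) : Measurable (rotMap φ) :=
  Measurable.ite measurableSet_Iio (by fun_prop) (by fun_prop)

theorem measurePreserving_rotMap {φ : ℝ} (hφ : φ ∈ Ico 0 π) :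
    MeasurePreserving (rotMap φ) (volume.restrict (Ico 0 π)) (volume.restrict (Ico 0 π)) := by
  obtain ⟨h0, hπ⟩ := hφ
  refine ⟨measurable_rotMap φ, ?_⟩
  ext s hs
  rw [Measure.map_apply (measurable_rotMap φ) hs, Measure.restrict_apply hs,
    Measure.restrict_apply (measurable_rotMap φ hs)]
  have hpre : rotMap φ ⁻¹' s ∩ Ico 0 π =
      (fun x => x + φ) ⁻¹' (s ∩ Ico φ π) ∪ (fun x => x + (φ - π)) ⁻¹' (s ∩ Ico 0 φ) := by
    ext x
    simp only [rotMap, mem_inter_iff, mem_preimage, mem_Ico, mem_union, ← add_sub_assoc]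
    split_ifs with h
    · constructor
      · rintro ⟨hx, h1, h2⟩
        exact Or.inl ⟨hx, by linarith, by linarith⟩
      · rintro (⟨hx, h1, h2⟩ | ⟨hx, h1, h2⟩)
        · exact ⟨hx, by linarith, by linarith⟩
        · linarith
    · constructor
      · rintro ⟨hx, h1, h2⟩
        exact Or.inr ⟨hx, by linarith, by linarith⟩
      · rintro (⟨hx, h1, h2⟩ | ⟨hx, h1, h2⟩)
        · linarith
        · exact ⟨hx, by linarith, by linarith⟩
  have hdisj : Disjoint ((fun x => x + φ) ⁻¹' (s ∩ Ico φ π))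
      ((fun x => x + (φ - π)) ⁻¹' (s ∩ Ico 0 φ)) := by
    rw [Set.disjoint_left]
    rintro x ⟨-, -, h1⟩ ⟨-, h2, -⟩
    dsimp only at h1 h2
    linarith
  have hsplit : s ∩ Ico 0 π = (s ∩ Ico φ π) ∪ (s ∩ Ico 0 φ) := by
    rw [← inter_union_distrib_left, union_comm, Ico_union_Ico_eq_Ico h0 hπ.le]
  have hdisj' : Disjoint (s ∩ Ico φ π) (s ∩ Ico 0 φ) := by
    rw [Set.disjoint_left]
    rintro x ⟨-, h1, -⟩ ⟨-, -, h2⟩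
    linarith
  rw [hpre, hsplit, measure_union hdisj' (hs.inter measurableSet_Ico),
    measure_union hdisj ((measurable_add_const _) (hs.inter measurableSet_Ico)),
    measure_preimage_add_right, measure_preimage_add_right]

theorem birkhoffSum_const_sub_indicator {α : Type*} (T : α → α) (J : Set α) (c : ℝ) (n : ℕ)
    (x : α) : birkhoffSum T (fun y => c - J.indicator 1 y) n x
      = n * c - ({k : ℕ | k < n ∧ T^[k] x ∈ J}.ncard : ℝ) := by
  classical
  have hset : {k : ℕ | k < n ∧ T^[k] x ∈ J} =
      ((Finset.range n).filter (T^[·] x ∈ J) : Finset ℕ) := by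
    ext k
    simp
  rw [hset, ncard_coe_finset, Finset.card_filter]
  simp [birkhoffSum, Finset.sum_sub_distrib, indicator_apply]

/-- Density of rotation maps: if `J ⊆ [0, π)` has Lebesgue measure at least `π − ε` and
`φ ∈ [0, π)`, then there is `θ ∈ [0, π)` whose orbit under the rotation `T_φ` visits `J`
with density at least `1 − ε/2` along every initial segment. -/
theorem statement17 (ε : ℝ) (hε : 0 < ε) (J : Set ℝ) (hJm : MeasurableSet J)
    (hJsub : J ⊆ Set.Ico 0 Real.pi)
    (hJvol : ENNReal.ofReal (Real.pi - ε) ≤ volume J)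
    (φ : ℝ) (hφ : φ ∈ Set.Ico 0 Real.pi) :
    ∃ θ ∈ Set.Ico (0 : ℝ) Real.pi, ∀ n : ℕ, 1 ≤ n →
      1 - ε / 2 ≤ (({k : ℕ | k < n ∧ (rotMap φ)^[k] θ ∈ J}).ncard : ℝ) / n := by
  by_contra! hcon
  set f : ℝ → ℝ := fun x => (1 - ε / 2) - J.indicator 1 x with hfdef
  have hfm : Measurable f := measurable_const.sub (measurable_one.indicator hJm)
  have hJi : Integrable (J.indicator (1 : ℝ → ℝ)) (volume.restrict (Ico 0 π)) :=
    (integrable_const (1 : ℝ)).indicator hJm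
  have hf : Integrable f (volume.restrict (Ico 0 π)) := (integrable_const _).sub hJi
  have hpos : ∀ᵐ x ∂(volume.restrict (Ico 0 π)), ∃ n, 0 < birkhoffSum (rotMap φ) f n x := by
    filter_upwards [ae_restrict_mem measurableSet_Ico] with x hx
    obtain ⟨n, hn, hlt⟩ := hcon x hx
    refine ⟨n, ?_⟩
    rw [div_lt_iff₀ (by exact_mod_cast hn)] at hlt
    rw [hfdef, birkhoffSum_const_sub_indicator]
    linarith
  have hint := integral_nonneg_of_ae_exists_birkhoffSum_pos
    (measurePreserving_rotMap hφ) hfm hf hpos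
  have hJfin : volume J ≠ ∞ := measure_ne_top_of_subset hJsub (by simp)
  have hJreal : π - ε ≤ volume.real J := (ENNReal.ofReal_le_iff_le_toReal hJfin).mp hJvol
  have hval : ∫ x in Ico 0 π, f x = π * (1 - ε / 2) - volume.real J := by
    rw [hfdef, integral_sub (integrable_const _) hJi, integral_indicator_one hJm,
      measureReal_restrict_apply hJm, inter_eq_left.mpr hJsub]
    simp [pi_pos.le]
  rw [hval] at hint
  nlinarith [mul_pos hε (sub_pos.mpr pi_gt_three)]
end
end
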